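/- Quadratic Morawetz estimate for the Hartree equation (Proposition 2.2(2), kernel form): let n ≥ 2 and let V : ℝⁿ → ℝ be smooth with all derivatives bounded, radial and nonincreasing, i.e. V(x) = v(|x|) with v' ≤ 0. Let u be a smooth decaying solution of the Hartree equation on all of ℝ with sup_t ‖u(t)‖_{L²} < ∞ and sup_t ‖∇u(t)‖_{L²} < ∞. Then ∫_ℝ ((n-1)/2) ∫∫ ∇ρ(t,x)·∇ρ(t,y)|x-y|^{-1} dx dy dt ≤ 2 (sup_t ‖u(t)‖_{L²})³ (sup_t ‖∇u(t)‖_{L²}). -/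

import Mathlib

open MeasureTheory Filter Complex

noncomputable section

/-- `ℝⁿ` as a Euclidean space. -/
abbrev Ed (n : ℕ) := EuclideanSpace ℝ (Fin n)

/-- Spatial partial derivative `∂_k` of a complex-valued function. -/
def pd {n : ℕ} (k : Fin n) (f : Ed n → ℂ) (x : Ed n) : ℂ :=
  fderiv ℝ f x (EuclideanSpace.single k 1)

/-- Spatial partial derivative `∂_k` of a real-valued function. -/
def pdR {n : ℕ} (k : Fin n) (f : Ed n → ℝ) (x : Ed n) : ℝ :=
  fderiv ℝ f x (EuclideanSpace.single k 1)

/-- Spatial Laplacian of a complex-valued function. -/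
def lapC {n : ℕ} (f : Ed n → ℂ) (x : Ed n) : ℂ := ∑ k, pd k (fun y => pd k f y) x

/-- Spatial Laplacian of a real-valued function. -/
def lapR {n : ℕ} (f : Ed n → ℝ) (x : Ed n) : ℝ := ∑ k, pdR k (fun y => pdR k f y) x

/-- Second partial derivative `∂_k ∂_l h`. -/
def hess {n : ℕ} (h : Ed n → ℝ) (k l : Fin n) (x : Ed n) : ℝ :=
  pdR k (fun y => pdR l h y) x

/-- `u(t,·)` and all its space-time derivatives are Schwartz in `x`,
uniformly for `t` in compact intervals. -/
def SchwartzDecay {n : ℕ} (u : ℝ → Ed n → ℂ) : Prop :=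
  ∀ (N m : ℕ) (a b : ℝ), ∃ C : ℝ, ∀ t ∈ Set.Icc a b, ∀ x : Ed n,
    (1 + ‖x‖) ^ m * ‖iteratedFDeriv ℝ N (fun p : ℝ × Ed n => u p.1 p.2) (t, x)‖ ≤ C

/-- A smooth decaying solution of the NLS equation `i ∂_t u = -(1/2) Δu + g(|u|²) u`. -/
def IsNLSSolution {n : ℕ} (g : ℝ → ℝ) (u : ℝ → Ed n → ℂ) : Prop :=
  ContDiff ℝ (⊤ : ℕ∞) (fun p : ℝ × Ed n => u p.1 p.2) ∧ SchwartzDecay u ∧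
    ∀ t x, Complex.I * deriv (fun s => u s x) t =
      -(1/2) * lapC (u t) x + ((g (‖u t x‖ ^ 2) : ℝ) : ℂ) * u t x

/-- Mass density `ρ = |u|²`. -/
def dens {n : ℕ} (u : ℝ → Ed n → ℂ) (t : ℝ) (x : Ed n) : ℝ := ‖u t x‖ ^ 2

/-- Mass current `j = Im (ū ∇u)`, `k`-th component. -/
def curr {n : ℕ} (u : ℝ → Ed n → ℂ) (k : Fin n) (t : ℝ) (x : Ed n) : ℝ :=
  ((starRingEnd ℂ) (u t x) * pd k (u t) x).im

/-- A smooth decaying solution of the Hartree equation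
`i ∂_t u = -(1/2) Δu + (V ⋆ |u|²) u`. -/
def IsHartreeSolution {n : ℕ} (V : Ed n → ℝ) (u : ℝ → Ed n → ℂ) : Prop :=
  ContDiff ℝ (⊤ : ℕ∞) (fun p : ℝ × Ed n => u p.1 p.2) ∧ SchwartzDecay u ∧
    ∀ t x, Complex.I * deriv (fun s => u s x) t =
      -(1/2) * lapC (u t) x + (((∫ y, V (x - y) * ‖u t y‖ ^ 2) : ℝ) : ℂ) * u t x

/-- Smooth space-time functions which decay rapidly in space, with all their derivatives, locally
uniformly in time. -/
def SmoothDecay {n : ℕ} {F : Type*} [NormedAddCommGroup F] [NormedSpace ℝ F]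
    (f : ℝ × Ed n → F) : Prop :=
  ContDiff ℝ (⊤ : ℕ∞) f ∧ ∀ (N m : ℕ) (a b : ℝ), ∃ C : ℝ, ∀ t ∈ Set.Icc a b, ∀ x : Ed n,
    (1 + ‖x‖) ^ m * ‖iteratedFDeriv ℝ N f (t, x)‖ ≤ C

/-- The integrable weight `(1 + ‖x‖)^{-(n+1)}`. -/
def decayWeight {n : ℕ} (x : Ed n) : ℝ := (1 + ‖x‖) ^ (-((n : ℝ) + 1))

/-- Time derivative of a space-time function. -/
def dt {n : ℕ} (f : ℝ × Ed n → ℝ) : ℝ × Ed n → ℝ := fun p => fderiv ℝ f p (1, 0)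

/-- Spatial partial derivative of a space-time function. -/
def dx {n : ℕ} (k : Fin n) (f : ℝ × Ed n → ℝ) : ℝ × Ed n → ℝ :=
  fun p => fderiv ℝ f p (0, EuclideanSpace.single k 1)

section SmoothDecay

variable {n : ℕ} {F G : Type*} [NormedAddCommGroup F] [NormedSpace ℝ F]
  [NormedAddCommGroup G] [NormedSpace ℝ G]

lemma decayWeight_nonneg (x : Ed n) : 0 ≤ decayWeight x := by
  unfold decayWeight; positivity

lemma decayWeight_le_one (x : Ed n) : decayWeight x ≤ 1 :=
  Real.rpow_le_one_of_one_le_of_nonpos (by linarith [norm_nonneg x])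
    (by linarith [Nat.cast_nonneg (α := ℝ) n])

lemma integrable_decayWeight : Integrable (decayWeight : Ed n → ℝ) :=
  integrable_one_add_norm (by simp)

lemma SmoothDecay.clm_comp (L : F →L[ℝ] G) {f : ℝ × Ed n → F} (hf : SmoothDecay f) :
    SmoothDecay (fun p => L (f p)) := by
  refine ⟨L.contDiff.comp hf.1, fun N m a b => ?_⟩
  obtain ⟨C, hC⟩ := hf.2 N m a b
  refine ⟨‖L‖ * C, fun t ht x => ?_⟩
  have h := L.norm_iteratedFDeriv_comp_left (x := (t, x)) (n := N) hf.1.contDiffAt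
    (by exact_mod_cast le_top)
  calc _ ≤ (1 + ‖x‖) ^ m * (‖L‖ * ‖iteratedFDeriv ℝ N f (t, x)‖) := by
        gcongr; exact h
    _ = ‖L‖ * ((1 + ‖x‖) ^ m * ‖iteratedFDeriv ℝ N f (t, x)‖) := by ring
    _ ≤ _ := by gcongr; exact hC t ht x

lemma SmoothDecay.fderiv {f : ℝ × Ed n → F} (hf : SmoothDecay f) :
    SmoothDecay (fderiv ℝ f) := by
  refine ⟨hf.1.fderiv_right (by simp), fun N m a b => ?_⟩
  obtain ⟨C, hC⟩ := hf.2 (N + 1) m a b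
  exact ⟨C, fun t ht x => by rw [norm_iteratedFDeriv_fderiv]; exact hC t ht x⟩

lemma SmoothDecay.fderiv_apply {f : ℝ × Ed n → F} (hf : SmoothDecay f) (e : ℝ × Ed n) :
    SmoothDecay (fun p => _root_.fderiv ℝ f p e) :=
  hf.fderiv.clm_comp (ContinuousLinearMap.apply ℝ F e)

lemma SmoothDecay.dt {f : ℝ × Ed n → ℝ} (hf : SmoothDecay f) : SmoothDecay (dt f) :=
  hf.fderiv_apply _

lemma SmoothDecay.dx {f : ℝ × Ed n → ℝ} (hf : SmoothDecay f) (k : Fin n) :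
    SmoothDecay (dx k f) :=
  hf.fderiv_apply _

lemma SmoothDecay.add {f g : ℝ × Ed n → F} (hf : SmoothDecay f) (hg : SmoothDecay g) :
    SmoothDecay (f + g) := by
  refine ⟨hf.1.add hg.1, fun N m a b => ?_⟩
  obtain ⟨C, hC⟩ := hf.2 N m a b
  obtain ⟨D, hD⟩ := hg.2 N m a b
  refine ⟨C + D, fun t ht x => ?_⟩
  rw [iteratedFDeriv_add_apply (hf.1.of_le (by exact_mod_cast le_top)).contDiffAt
    (hg.1.of_le (by exact_mod_cast le_top)).contDiffAt]
  calc _ ≤ (1 + ‖x‖) ^ m * (‖iteratedFDeriv ℝ N f (t, x)‖ + ‖iteratedFDeriv ℝ N g (t, x)‖) := by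
        gcongr; exact norm_add_le _ _
    _ ≤ _ := by rw [mul_add]; exact add_le_add (hC t ht x) (hD t ht x)

lemma SmoothDecay.neg {f : ℝ × Ed n → ℝ} (hf : SmoothDecay f) : SmoothDecay (-f) :=
  hf.clm_comp (-ContinuousLinearMap.id ℝ ℝ)

lemma SmoothDecay.sub {f g : ℝ × Ed n → ℝ} (hf : SmoothDecay f) (hg : SmoothDecay g) :
    SmoothDecay (f - g) := by
  rw [sub_eq_add_neg]; exact hf.add hg.neg

lemma SmoothDecay.zero : SmoothDecay (0 : ℝ × Ed n → ℝ) := by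
  refine ⟨contDiff_const, fun N m a b => ⟨0, fun t _ x => ?_⟩⟩
  have : (0 : ℝ × Ed n → ℝ) = fun _ => 0 := rfl
  rw [this]
  simp

lemma SmoothDecay.sum {ι : Type*} {s : Finset ι} {f : ι → ℝ × Ed n → ℝ}
    (hf : ∀ i ∈ s, SmoothDecay (f i)) : SmoothDecay (∑ i ∈ s, f i) :=
  Finset.sum_induction f SmoothDecay (fun _ _ => SmoothDecay.add) SmoothDecay.zero hf

lemma SmoothDecay.mul {f g : ℝ × Ed n → ℝ} (hf : SmoothDecay f) (hg : SmoothDecay g) :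
    SmoothDecay (f * g) := by
  refine ⟨hf.1.mul hg.1, fun N m a b => ?_⟩
  choose C hC using fun i => hf.2 i m a b
  choose D hD using fun i => hg.2 i 0 a b
  refine ⟨∑ i ∈ Finset.range (N + 1), (N.choose i : ℝ) * (C i * D (N - i)), fun t ht x => ?_⟩
  have h := norm_iteratedFDeriv_mul_le hf.1 hg.1 (t, x) (n := N) (by exact_mod_cast le_top)
  calc _ ≤ (1 + ‖x‖) ^ m * ∑ i ∈ Finset.range (N + 1),
        (N.choose i : ℝ) * ‖iteratedFDeriv ℝ i f (t, x)‖ * ‖iteratedFDeriv ℝ (N - i) g (t, x)‖ := by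
        gcongr; exact h
    _ = ∑ i ∈ Finset.range (N + 1), (N.choose i : ℝ) *
        (((1 + ‖x‖) ^ m * ‖iteratedFDeriv ℝ i f (t, x)‖) *
          ((1 + ‖x‖) ^ 0 * ‖iteratedFDeriv ℝ (N - i) g (t, x)‖)) := by
        rw [Finset.mul_sum]; exact Finset.sum_congr rfl fun i _ => by ring
    _ ≤ _ := by
        gcongr with i hi
        · exact le_trans (by positivity) (hC i t ht x)
        · exact hC i t ht x
        · exact hD (N - i) t ht x

lemma SmoothDecay.differentiable {f : ℝ × Ed n → F} (hf : SmoothDecay f) : Differentiable ℝ f :=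
  hf.1.differentiable (by simp)

lemma SmoothDecay.continuous {f : ℝ × Ed n → F} (hf : SmoothDecay f) : Continuous f :=
  hf.1.continuous

lemma SmoothDecay.exists_le_decayWeight {f : ℝ × Ed n → F} (hf : SmoothDecay f) (a b : ℝ) :
    ∃ C : ℝ, 0 ≤ C ∧ ∀ t ∈ Set.Icc a b, ∀ x, ‖f (t, x)‖ ≤ C * decayWeight x := by
  obtain ⟨C, hC⟩ := hf.2 0 (n + 1) a b
  refine ⟨max C 0, le_max_right _ _, fun t ht x => ?_⟩
  have h := hC t ht x
  have hp : 0 < (1 + ‖x‖) ^ (n + 1) := by positivity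
  have hw : decayWeight x = ((1 + ‖x‖) ^ (n + 1))⁻¹ := by
    unfold decayWeight
    rw [Real.rpow_neg (by positivity), ← Real.rpow_natCast]
    push_cast
    rfl
  rw [norm_iteratedFDeriv_zero] at h
  rw [hw, ← div_eq_mul_inv, le_div_iff₀ hp, mul_comm]
  exact h.trans (le_max_left _ _)

lemma SmoothDecay.slice_continuous {f : ℝ × Ed n → F} (hf : SmoothDecay f) (t : ℝ) :
    Continuous fun x => f (t, x) :=
  hf.continuous.comp (by fun_prop)

lemma SmoothDecay.slice_differentiable {f : ℝ × Ed n → F} (hf : SmoothDecay f) (t : ℝ) :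
    Differentiable ℝ fun x => f (t, x) :=
  hf.differentiable.comp (by fun_prop)

lemma SmoothDecay.slice_integrable {f : ℝ × Ed n → F} (hf : SmoothDecay f) (t : ℝ) :
    Integrable fun x => f (t, x) := by
  obtain ⟨C, -, hC⟩ := hf.exists_le_decayWeight t t
  exact (integrable_decayWeight.const_mul C).mono' (hf.slice_continuous t).aestronglyMeasurable
    (ae_of_all _ fun x => hC t (by simp) x)

lemma fderiv_slice_apply {f : ℝ × Ed n → F} (hf : Differentiable ℝ f) (t : ℝ) (x e : Ed n) :
    fderiv ℝ (fun y => f (t, y)) x e = fderiv ℝ f (t, x) (0, e) := by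
  have h : HasFDerivAt (fun y : Ed n => f (t, y)) _ x :=
    (hf (t, x)).hasFDerivAt.comp x (hasFDerivAt_prodMk_right t x)
  rw [h.fderiv]
  simp

lemma pdR_slice {f : ℝ × Ed n → ℝ} (hf : Differentiable ℝ f) (k : Fin n) (t : ℝ) (x : Ed n) :
    pdR k (fun y => f (t, y)) x = dx k f (t, x) :=
  fderiv_slice_apply hf t x _

lemma hasDerivAt_slice {f : ℝ × Ed n → F} (hf : Differentiable ℝ f) (t : ℝ) (x : Ed n) :
    HasDerivAt (fun s => f (s, x)) (fderiv ℝ f (t, x) (1, 0)) t := by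
  have h : HasFDerivAt (fun s : ℝ => f (s, x)) _ t :=
    (hf (t, x)).hasFDerivAt.comp t (hasFDerivAt_prodMk_left t x)
  simpa using h.hasDerivAt

lemma fderiv_fderiv_comm {f : ℝ × Ed n → ℝ} (hf : SmoothDecay f) (e e' p : ℝ × Ed n) :
    fderiv ℝ (fun q => fderiv ℝ f q e) p e' = fderiv ℝ (fun q => fderiv ℝ f q e') p e := by
  have h := hf.fderiv.differentiable
  have hs : IsSymmSndFDerivAt ℝ f p := hf.1.contDiffAt.isSymmSndFDerivAt
    (by rw [minSmoothness_of_isRCLikeNormedField]; exact WithTop.coe_le_coe.2 le_top)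
  rw [fderiv_clm_apply (h p) (differentiableAt_const _),
    fderiv_clm_apply (h p) (differentiableAt_const _)]
  simpa using hs.eq e' e

lemma dx_comm {f : ℝ × Ed n → ℝ} (hf : SmoothDecay f) (k l : Fin n) :
    dx k (dx l f) = dx l (dx k f) := funext fun p => fderiv_fderiv_comm hf _ _ p

lemma dt_dx {f : ℝ × Ed n → ℝ} (hf : SmoothDecay f) (k : Fin n) :
    dt (dx k f) = dx k (dt f) := funext fun p => fderiv_fderiv_comm hf _ _ p

section Rules

variable {f g : ℝ × Ed n → ℝ} (k : Fin n)

lemma fderiv_apply_mul_of_smoothDecay (hf : SmoothDecay f) (hg : SmoothDecay g) (p e : ℝ × Ed n) :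
    fderiv ℝ (f * g) p e = fderiv ℝ f p e * g p + f p * fderiv ℝ g p e := by
  rw [fderiv_mul (hf.differentiable p) (hg.differentiable p)]
  simp; ring

lemma dx_mul (hf : SmoothDecay f) (hg : SmoothDecay g) :
    dx k (f * g) = dx k f * g + f * dx k g :=
  funext fun p => fderiv_apply_mul_of_smoothDecay hf hg p _

lemma dt_mul (hf : SmoothDecay f) (hg : SmoothDecay g) :
    dt (f * g) = dt f * g + f * dt g :=
  funext fun p => fderiv_apply_mul_of_smoothDecay hf hg p _

lemma dx_add (hf : SmoothDecay f) (hg : SmoothDecay g) : dx k (f + g) = dx k f + dx k g := by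
  funext p; unfold dx; rw [fderiv_add (hf.differentiable p) (hg.differentiable p)]; simp

lemma dt_add (hf : SmoothDecay f) (hg : SmoothDecay g) : dt (f + g) = dt f + dt g := by
  funext p; unfold dt; rw [fderiv_add (hf.differentiable p) (hg.differentiable p)]; simp

lemma dx_sub (hf : SmoothDecay f) (hg : SmoothDecay g) : dx k (f - g) = dx k f - dx k g := by
  funext p; unfold dx; rw [fderiv_sub (hf.differentiable p) (hg.differentiable p)]; simp

lemma dt_sub (hf : SmoothDecay f) (hg : SmoothDecay g) : dt (f - g) = dt f - dt g := by
  funext p; unfold dt; rw [fderiv_sub (hf.differentiable p) (hg.differentiable p)]; simp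

end Rules

end SmoothDecay

/-- The bilinear interaction `∬ f(x) K(y - x) g(y) dx dy`. -/
def interaction {n : ℕ} (K f g : Ed n → ℝ) : ℝ :=
  ∫ p : Ed n × Ed n, f p.1 * K (p.2 - p.1) * g p.2

/-- Bounded continuous kernels. -/
def BddKernel {n : ℕ} (K : Ed n → ℝ) : Prop := Continuous K ∧ ∃ C, ∀ z, |K z| ≤ C

section Interaction

variable {n : ℕ} {K f g : Ed n → ℝ}

lemma BddKernel.integrable_mul_left (hK : BddKernel K) (hg : Integrable g) (x : Ed n) :
    Integrable fun y => K (y - x) * g y := by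
  obtain ⟨hc, C, hC⟩ := hK
  exact hg.bdd_mul (hc.comp (by fun_prop)).aestronglyMeasurable (ae_of_all _ fun y => hC _)

lemma BddKernel.integrable_mul_right (hK : BddKernel K) (hf : Integrable f) (y : Ed n) :
    Integrable fun x => f x * K (y - x) := by
  obtain ⟨hc, C, hC⟩ := hK
  simp_rw [mul_comm (f _)]
  exact hf.bdd_mul (hc.comp (by fun_prop)).aestronglyMeasurable (ae_of_all _ fun y => hC _)

lemma BddKernel.integrable_interaction (hK : BddKernel K) (hf : Integrable f)
    (hg : Integrable g) :
    Integrable fun p : Ed n × Ed n => f p.1 * K (p.2 - p.1) * g p.2 := by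
  obtain ⟨hc, C, hC⟩ := hK
  have h := (hf.mul_prod hg).bdd_mul (f := fun p : Ed n × Ed n => K (p.2 - p.1)) (c := C)
    (hc.comp (by fun_prop)).aestronglyMeasurable (ae_of_all _ fun p => hC _)
  exact h.congr (ae_of_all _ fun p => by ring)

lemma interaction_eq_iterated (hK : BddKernel K) (hf : Integrable f) (hg : Integrable g) :
    interaction K f g = ∫ x, f x * ∫ y, K (y - x) * g y := by
  unfold interaction
  rw [Measure.volume_eq_prod, integral_prod _ (hK.integrable_interaction hf hg)]
  simp_rw [mul_assoc, integral_const_mul]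

lemma interaction_eq_iterated_symm (hK : BddKernel K) (hf : Integrable f) (hg : Integrable g) :
    interaction K f g = ∫ y, (∫ x, f x * K (y - x)) * g y := by
  unfold interaction
  rw [Measure.volume_eq_prod, integral_prod_symm _ (hK.integrable_interaction hf hg)]
  simp_rw [integral_mul_const]

lemma interaction_add_right (hK : BddKernel K) (hf : Integrable f) (hg : Integrable g)
    {g' : Ed n → ℝ} (hg' : Integrable g') :
    interaction K f (fun x => g x + g' x) = interaction K f g + interaction K f g' := by
  unfold interaction
  rw [← integral_add (hK.integrable_interaction hf hg) (hK.integrable_interaction hf hg')]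
  simp_rw [mul_add]

lemma interaction_const_mul_right (c : ℝ) :
    interaction K f (fun x => c * g x) = c * interaction K f g := by
  unfold interaction
  rw [← integral_const_mul]
  congr 1; ext p; ring

lemma interaction_neg_right :
    interaction K f (fun x => - g x) = - interaction K f g := by
  unfold interaction
  rw [← integral_neg]
  congr 1; ext p; ring

lemma interaction_sum_right (hK : BddKernel K) (hf : Integrable f) {ι : Type*} {s : Finset ι}
    {g : ι → Ed n → ℝ} (hg : ∀ i ∈ s, Integrable (g i)) :
    interaction K f (fun x => ∑ i ∈ s, g i x) = ∑ i ∈ s, interaction K f (g i) := by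
  unfold interaction
  rw [← integral_finsetSum _ fun i hi => hK.integrable_interaction hf (hg i hi)]
  simp_rw [Finset.mul_sum]

lemma interaction_neg_sum_left (hK : BddKernel K) (hg : Integrable g) {ι : Type*} {s : Finset ι}
    {f : ι → Ed n → ℝ} (hf : ∀ i ∈ s, Integrable (f i)) :
    interaction K (fun x => -∑ i ∈ s, f i x) g = -∑ i ∈ s, interaction K (f i) g := by
  unfold interaction
  rw [← integral_finsetSum _ fun i hi => hK.integrable_interaction (hf i hi) hg, ← integral_neg]
  simp_rw [neg_mul, Finset.sum_mul]

lemma interaction_pdR_right (k : Fin n) (hK : BddKernel K) (hKd : Differentiable ℝ K)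
    (hK' : BddKernel (pdR k K)) (hf : Integrable f) (hg : Integrable g)
    (hgd : Differentiable ℝ g) (hg' : Integrable (pdR k g)) :
    interaction K f (pdR k g) = - interaction (pdR k K) f g := by
  rw [interaction_eq_iterated hK hf hg', interaction_eq_iterated hK' hf hg, ← integral_neg]
  refine integral_congr_ae (ae_of_all _ fun x => ?_)
  have hd : ∀ y, fderiv ℝ (fun y => K (y - x)) y (EuclideanSpace.single k 1) = pdR k K (y - x) :=
    fun y => by rw [fderiv_comp_sub]; rfl
  have h := integral_mul_fderiv_eq_neg_fderiv_mul_of_integrable (μ := volume)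
    (f := fun y => K (y - x)) (g := g) (v := EuclideanSpace.single k 1)
    (by simp_rw [hd]; exact hK'.integrable_mul_left hg x) (hK.integrable_mul_left hg' x)
    (hK.integrable_mul_left hg x)
    (fun y _ => (hKd.comp (by fun_prop : Differentiable ℝ fun y : Ed n => y - x)) y)
    (fun y _ => hgd y)
  simp_rw [hd] at h
  simp only [pdR] at h ⊢
  rw [h, mul_neg]

lemma interaction_pdR_left (k : Fin n) (hK : BddKernel K) (hKd : Differentiable ℝ K)
    (hK' : BddKernel (pdR k K)) (hf : Integrable f) (hg : Integrable g)
    (hfd : Differentiable ℝ f) (hf' : Integrable (pdR k f)) :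
    interaction K (pdR k f) g = interaction (pdR k K) f g := by
  rw [interaction_eq_iterated_symm hK hf' hg, interaction_eq_iterated_symm hK' hf hg]
  refine integral_congr_ae (ae_of_all _ fun y => ?_)
  have hd : ∀ x, fderiv ℝ (fun x => K (y - x)) x (EuclideanSpace.single k 1)
      = - pdR k K (y - x) := fun x => by
    have h := (hKd (y - x)).hasFDerivAt.comp x ((hasFDerivAt_id x).const_sub y)
    have h' : fderiv ℝ (fun x => K (y - x)) x = _ := h.fderiv
    rw [h']
    simp [pdR]
  have h := integral_mul_fderiv_eq_neg_fderiv_mul_of_integrable (μ := volume)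
    (f := f) (g := fun x => K (y - x)) (v := EuclideanSpace.single k 1)
    (hK.integrable_mul_right hf' y)
    (by simp_rw [hd, mul_neg]; exact (hK'.integrable_mul_right hf y).neg)
    (hK.integrable_mul_right hf y)
    (fun x _ => hfd x)
    (fun x _ => (hKd.comp (by fun_prop : Differentiable ℝ fun x : Ed n => y - x)) x)
  simp_rw [hd, mul_neg, integral_neg, neg_inj] at h
  simp only [pdR] at h ⊢
  rw [h]

lemma hasDerivAt_interaction (hK : BddKernel K) {F G : ℝ × Ed n → ℝ} (hF : SmoothDecay F)
    (hG : SmoothDecay G) (t : ℝ) :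
    HasDerivAt (fun s => interaction K (fun x => F (s, x)) (fun y => G (s, y)))
      (interaction K (fun x => dt F (t, x)) (fun y => G (t, y))
        + interaction K (fun x => F (t, x)) (fun y => dt G (t, y))) t := by
  obtain ⟨CK, hCK⟩ := hK.2
  have hCK0 : 0 ≤ CK := (abs_nonneg _).trans (hCK 0)
  obtain ⟨A, hA0, hA⟩ := hF.exists_le_decayWeight (t - 1) (t + 1)
  obtain ⟨A', hA'0, hA'⟩ := hF.dt.exists_le_decayWeight (t - 1) (t + 1)
  obtain ⟨D, hD0, hD⟩ := hG.exists_le_decayWeight (t - 1) (t + 1)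
  obtain ⟨D', hD'0, hD'⟩ := hG.dt.exists_le_decayWeight (t - 1) (t + 1)
  have hint := fun s => hK.integrable_interaction (hF.slice_integrable s) (hG.slice_integrable s)
  have hint1 := fun s => hK.integrable_interaction (hF.dt.slice_integrable s)
    (hG.slice_integrable s)
  have hint2 := fun s => hK.integrable_interaction (hF.slice_integrable s)
    (hG.dt.slice_integrable s)
  unfold interaction
  rw [← integral_add (hint1 t) (hint2 t)]
  refine (hasDerivAt_integral_of_dominated_loc_of_deriv_le
    (F := fun s (p : Ed n × Ed n) => F (s, p.1) * K (p.2 - p.1) * G (s, p.2))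
    (F' := fun s (p : Ed n × Ed n) => dt F (s, p.1) * K (p.2 - p.1) * G (s, p.2)
      + F (s, p.1) * K (p.2 - p.1) * dt G (s, p.2))
    (bound := fun p => (A' * D + A * D') * CK * (decayWeight p.1 * decayWeight p.2))
    (s := Set.Icc (t - 1) (t + 1))
    (Icc_mem_nhds (by linarith) (by linarith)) (Eventually.of_forall fun s => (hint s).1) (hint t)
    ((hint1 t).add (hint2 t)).1 (ae_of_all _ fun p s hs => ?_) ?_
    (ae_of_all _ fun p s _ => ?_)).2
  · have w1 := decayWeight_nonneg p.1
    have w2 := decayWeight_nonneg p.2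
    calc _ ≤ ‖dt F (s, p.1)‖ * |K (p.2 - p.1)| * ‖G (s, p.2)‖
          + ‖F (s, p.1)‖ * |K (p.2 - p.1)| * ‖dt G (s, p.2)‖ := by
          refine (norm_add_le _ _).trans_eq ?_
          simp only [norm_mul, Real.norm_eq_abs]
      _ ≤ (A' * decayWeight p.1) * CK * (D * decayWeight p.2)
          + (A * decayWeight p.1) * CK * (D' * decayWeight p.2) := by
          gcongr
          exacts [hA' s hs _, hCK _, hD s hs _, hA s hs _, hCK _, hD' s hs _]
      _ = _ := by ring
  · exact (integrable_decayWeight.mul_prod integrable_decayWeight).const_mul _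
  · exact ((hasDerivAt_slice hF.differentiable s p.1).mul_const _).mul
      (hasDerivAt_slice hG.differentiable s p.2)

end Interaction

/-- The smooth convex regularization `√(‖z‖² + ε²)` of the norm. -/
def regNorm {n : ℕ} (ε : ℝ) (z : Ed n) : ℝ := √(‖z‖ ^ 2 + ε ^ 2)

/-- The gradient of `regNorm ε`. -/
def gradKernel {n : ℕ} (ε : ℝ) (k : Fin n) (z : Ed n) : ℝ := z k / regNorm ε z

/-- The Hessian of `regNorm ε`. -/
def hessKernel {n : ℕ} (ε : ℝ) (k l : Fin n) (z : Ed n) : ℝ :=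
  (if k = l then 1 else 0) / regNorm ε z - z k * z l / regNorm ε z ^ 3

section Kernel

variable {n : ℕ} {ε : ℝ} (z : Ed n)

lemma regNorm_pos (hε : 0 < ε) : 0 < regNorm ε z := Real.sqrt_pos.2 (by positivity)

lemma regNorm_sq : regNorm ε z ^ 2 = ‖z‖ ^ 2 + ε ^ 2 := Real.sq_sqrt (by positivity)

lemma norm_le_regNorm : ‖z‖ ≤ regNorm ε z := Real.le_sqrt_of_sq_le (by nlinarith [sq_nonneg ε])

lemma le_regNorm : ε ≤ regNorm ε z := Real.le_sqrt_of_sq_le (by nlinarith [sq_nonneg ‖z‖])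

lemma regNorm_neg : regNorm ε (-z) = regNorm ε z := by simp [regNorm]

lemma hessKernel_neg (k l : Fin n) : hessKernel ε k l (-z) = hessKernel ε k l z := by
  simp [hessKernel, regNorm_neg]

lemma continuous_regNorm : Continuous (regNorm ε : Ed n → ℝ) := by
  unfold regNorm; fun_prop

lemma abs_coord_le (k : Fin n) : |z k| ≤ ‖z‖ := PiLp.norm_apply_le z k

lemma sum_coord_mul (x y : Ed n) : ∑ k, x k * y k = inner ℝ x y := by
  rw [PiLp.inner_apply]
  exact Finset.sum_congr rfl fun k _ => by simp [mul_comm]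

lemma sum_coord_sq (x : Ed n) : ∑ k, x k * x k = ‖x‖ ^ 2 := by
  rw [sum_coord_mul, real_inner_self_eq_norm_sq]

lemma hasFDerivAt_regNorm (hε : 0 < ε) :
    HasFDerivAt (regNorm ε) ((1 / (2 * regNorm ε z)) • (2 • innerSL ℝ z)) z := by
  have h := ((hasStrictFDerivAt_norm_sq z).hasFDerivAt.add_const (ε ^ 2)).sqrt
    (by positivity)
  exact h

lemma hasFDerivAt_gradKernel (hε : 0 < ε) (k : Fin n) :
    HasFDerivAt (gradKernel ε k)
      (z k • ((-(regNorm ε z ^ 2)⁻¹) • ((1 / (2 * regNorm ε z)) • (2 • innerSL ℝ z)))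
        + (regNorm ε z)⁻¹ • (EuclideanSpace.proj k : Ed n →L[ℝ] ℝ)) z := by
  have h1 : HasFDerivAt (fun z : Ed n => z k) (EuclideanSpace.proj k : Ed n →L[ℝ] ℝ) z :=
    (EuclideanSpace.proj k : Ed n →L[ℝ] ℝ).hasFDerivAt
  exact h1.mul ((hasDerivAt_inv (regNorm_pos z hε).ne').comp_hasFDerivAt z
    (hasFDerivAt_regNorm z hε))

lemma differentiable_gradKernel (hε : 0 < ε) (k : Fin n) :
    Differentiable ℝ (gradKernel ε k : Ed n → ℝ) :=
  fun z => (hasFDerivAt_gradKernel z hε k).differentiableAt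

lemma pdR_gradKernel (hε : 0 < ε) (k l : Fin n) :
    pdR l (gradKernel ε k) = hessKernel ε k l := by
  funext z
  have hp := regNorm_pos z hε
  rw [pdR, (hasFDerivAt_gradKernel z hε k).fderiv, hessKernel]
  have : inner ℝ z (EuclideanSpace.single l 1) = z l := by
    rw [← sum_coord_mul]; simp
  simp [this, PiLp.single_apply]
  split_ifs <;> field_simp <;> ring

lemma abs_gradKernel_le (hε : 0 < ε) (k : Fin n) : |gradKernel ε k z| ≤ 1 := by
  rw [gradKernel, abs_div, abs_of_pos (regNorm_pos z hε), div_le_one (regNorm_pos z hε)]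
  exact (abs_coord_le z k).trans (norm_le_regNorm z)

lemma bddKernel_gradKernel (hε : 0 < ε) (k : Fin n) :
    BddKernel (gradKernel ε k : Ed n → ℝ) :=
  ⟨(differentiable_gradKernel hε k).continuous, 1, fun z => abs_gradKernel_le z hε k⟩

lemma bddKernel_hessKernel (hε : 0 < ε) (k l : Fin n) :
    BddKernel (hessKernel ε k l : Ed n → ℝ) := by
  refine ⟨?_, 1 / ε + 1 / ε, fun z => ?_⟩
  · unfold hessKernel
    exact (continuous_const.div continuous_regNorm fun z => (regNorm_pos z hε).ne').sub
      (Continuous.div (by fun_prop) (continuous_regNorm.pow 3)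
        fun z => (pow_pos (regNorm_pos z hε) 3).ne')
  · have hp := regNorm_pos z hε
    have he : 1 / regNorm ε z ≤ 1 / ε := one_div_le_one_div_of_le hε (le_regNorm z)
    refine (abs_sub _ _).trans (add_le_add ?_ ?_)
    · refine le_trans ?_ he
      rw [abs_div, abs_of_pos hp]
      gcongr
      split_ifs <;> simp
    · refine le_trans ?_ he
      have h1 := (abs_coord_le z k).trans (norm_le_regNorm (ε := ε) z)
      have h2 := (abs_coord_le z l).trans (norm_le_regNorm (ε := ε) z)
      rw [abs_div, abs_of_pos (pow_pos hp 3), abs_mul, div_le_div_iff₀ (pow_pos hp 3) hp]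
      calc |z k| * |z l| * regNorm ε z ≤ regNorm ε z * regNorm ε z * regNorm ε z := by gcongr
        _ = _ := by ring

lemma trace_hessKernel (hε : 0 < ε) :
    ∑ k, hessKernel ε k k z = ((n : ℝ) - 1) / regNorm ε z + ε ^ 2 / regNorm ε z ^ 3 := by
  have hp := regNorm_pos z hε
  simp only [hessKernel, if_true, Finset.sum_sub_distrib, ← Finset.sum_div, sum_coord_sq]
  simp only [Finset.sum_const, Finset.card_univ, Fintype.card_fin, nsmul_eq_mul, mul_one]
  field_simp
  rw [regNorm_sq]
  ring

lemma trace_hessKernel_nonneg (hε : 0 < ε) (hn : 1 ≤ n) : 0 ≤ ∑ k, hessKernel ε k k z := by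
  have hp := regNorm_pos z hε
  have : (0 : ℝ) ≤ n - 1 := by simpa using (by exact_mod_cast hn : (1 : ℝ) ≤ n)
  rw [trace_hessKernel z hε]
  positivity

lemma trace_hessKernel_le (hε : 0 < ε) (hz : z ≠ 0) :
    ∑ k, hessKernel ε k k z ≤ n * ‖z‖⁻¹ := by
  have hp := regNorm_pos z hε
  have hz' := norm_pos_iff.2 hz
  have h1 : ε ^ 2 / regNorm ε z ^ 3 ≤ 1 / regNorm ε z := by
    rw [div_le_div_iff₀ (pow_pos hp 3) hp]
    nlinarith [regNorm_sq (ε := ε) z, mul_nonneg hp.le (sq_nonneg ‖z‖)]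
  calc _ = ((n : ℝ) - 1) / regNorm ε z + ε ^ 2 / regNorm ε z ^ 3 := trace_hessKernel z hε
    _ ≤ ((n : ℝ) - 1) / regNorm ε z + 1 / regNorm ε z := by gcongr
    _ = n * (regNorm ε z)⁻¹ := by ring
    _ ≤ _ := by
      gcongr
      exact norm_le_regNorm z

lemma tendsto_trace_hessKernel (hz : z ≠ 0) :
    Tendsto (fun ε => ∑ k, hessKernel ε k k z) (nhdsWithin 0 (Set.Ioi 0))
      (nhds (((n : ℝ) - 1) * ‖z‖⁻¹)) := by
  have hz' := norm_pos_iff.2 hz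
  have hr : ContinuousAt (fun ε => regNorm ε z) 0 := by
    unfold regNorm; fun_prop
  have h0 : regNorm 0 z = ‖z‖ := by simp [regNorm]
  have hc : ContinuousAt (fun ε => ((n : ℝ) - 1) / regNorm ε z + ε ^ 2 / regNorm ε z ^ 3) 0 := by
    refine ContinuousAt.add (continuousAt_const.div hr ?_) (ContinuousAt.div (by fun_prop)
      (hr.pow 3) ?_)
    · rw [h0]; exact hz'.ne'
    · rw [h0]; positivity
  have := hc.tendsto.mono_left (nhdsWithin_le_nhds (s := Set.Ioi 0))
  simp only [h0] at this
  refine (this.congr' ?_).trans_eq (by simp [div_eq_mul_inv])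
  filter_upwards [self_mem_nhdsWithin] with ε hε using (trace_hessKernel z hε).symm

lemma hessKernel_quadratic_nonneg (hε : 0 < ε) (X : Fin n → ℝ) :
    0 ≤ ∑ k, ∑ l, hessKernel ε k l z * (X l * X k) := by
  have hp := regNorm_pos z hε
  set Y : Ed n := WithLp.toLp 2 X
  have h1 : ∑ k, ∑ l, hessKernel ε k l z * (X l * X k)
      = ‖Y‖ ^ 2 / regNorm ε z - (inner ℝ z Y) ^ 2 / regNorm ε z ^ 3 := by
    have hY : ∀ k, Y k = X k := fun k => rfl
    rw [← sum_coord_sq, sq (inner ℝ z Y), ← sum_coord_mul, Finset.sum_mul_sum, Finset.sum_div,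
      Finset.sum_div, ← Finset.sum_sub_distrib]
    refine Finset.sum_congr rfl fun k _ => ?_
    simp only [hessKernel, sub_mul, Finset.sum_sub_distrib, hY, Finset.sum_div, ite_div, zero_div,
      ite_mul, zero_mul, Finset.sum_ite_eq, Finset.mem_univ, if_true]
    congr 1
    · ring
    · exact Finset.sum_congr rfl fun l _ => by ring
  have h2 : (inner ℝ z Y) ^ 2 ≤ regNorm ε z ^ 2 * ‖Y‖ ^ 2 := by
    have := abs_real_inner_le_norm z Y
    rw [← mul_pow, ← sq_abs (inner ℝ z Y)]
    gcongr
    exact this.trans (by gcongr; exact norm_le_regNorm z)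
  rw [h1, sub_nonneg, div_le_div_iff₀ (pow_pos hp 3) hp]
  nlinarith [mul_le_mul_of_nonneg_right h2 hp.le]

lemma sum_gradKernel_sq_le (hε : 0 < ε) : ∑ k, gradKernel ε k z ^ 2 ≤ 1 := by
  have hp := regNorm_pos z hε
  have : ∑ k, gradKernel ε k z ^ 2 = ‖z‖ ^ 2 / regNorm ε z ^ 2 := by
    rw [← sum_coord_sq, Finset.sum_div]
    exact Finset.sum_congr rfl fun k _ => by rw [gradKernel, div_pow, sq (z k)]
  rw [this, div_le_one (by positivity), regNorm_sq]
  nlinarith [sq_nonneg ε]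

lemma gradKernel_monotone (hε : 0 < ε) (p q : Ed n) :
    0 ≤ ∑ k, (gradKernel ε k p - gradKernel ε k q) * (p - q) k := by
  have hp := regNorm_pos p hε
  have hq := regNorm_pos q hε
  have h1 : ∑ k, (gradKernel ε k p - gradKernel ε k q) * (p - q) k
      = ‖p‖ ^ 2 / regNorm ε p + ‖q‖ ^ 2 / regNorm ε q
        - inner ℝ p q * (1 / regNorm ε p + 1 / regNorm ε q) := by
    rw [← sum_coord_sq, ← sum_coord_sq, ← sum_coord_mul, Finset.sum_div, Finset.sum_div,
      Finset.sum_mul, ← Finset.sum_add_distrib, ← Finset.sum_sub_distrib]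
    refine Finset.sum_congr rfl fun k _ => ?_
    simp only [gradKernel, PiLp.sub_apply]
    ring
  have h2 : inner ℝ p q * (1 / regNorm ε p + 1 / regNorm ε q)
      ≤ (‖p‖ * ‖q‖) * (1 / regNorm ε p + 1 / regNorm ε q) := by
    gcongr
    exact real_inner_le_norm p q
  have h3 : 0 ≤ (‖p‖ - ‖q‖) * (‖p‖ / regNorm ε p - ‖q‖ / regNorm ε q) := by
    have key : ∀ a b : Ed n, ‖a‖ ≤ ‖b‖ → ‖a‖ / regNorm ε a ≤ ‖b‖ / regNorm ε b := fun a b hab => by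
      have ha := regNorm_pos a hε
      have hb := regNorm_pos b hε
      rw [div_le_div_iff₀ ha hb]
      refine le_of_sq_le_sq ?_ (by positivity)
      rw [mul_pow, mul_pow, regNorm_sq, regNorm_sq]
      have : ‖a‖ ^ 2 ≤ ‖b‖ ^ 2 := by gcongr
      nlinarith [sq_nonneg ε, mul_le_mul_of_nonneg_right this (sq_nonneg ε)]
    rcases le_total ‖p‖ ‖q‖ with h | h
    · exact mul_nonneg_of_nonpos_of_nonpos (sub_nonpos.2 h) (sub_nonpos.2 (key _ _ h))
    · exact mul_nonneg (sub_nonneg.2 h) (sub_nonneg.2 (key _ _ h))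
  have h4 : (‖p‖ - ‖q‖) * (‖p‖ / regNorm ε p - ‖q‖ / regNorm ε q)
      = ‖p‖ ^ 2 / regNorm ε p + ‖q‖ ^ 2 / regNorm ε q
        - (‖p‖ * ‖q‖) * (1 / regNorm ε p + 1 / regNorm ε q) := by ring
  linarith

end Kernel

/-- Mass density of `a + ib`. -/
def massDensity {n : ℕ} (a b : ℝ × Ed n → ℝ) : ℝ × Ed n → ℝ := a * a + b * b

/-- Momentum density of `a + ib`. -/
def momentum {n : ℕ} (a b : ℝ × Ed n → ℝ) (k : Fin n) : ℝ × Ed n → ℝ :=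
  a * dx k b - b * dx k a

/-- Kinetic stress tensor `Re (∂_k u ∂_l ū)` of `u = a + ib`. -/
def stress {n : ℕ} (a b : ℝ × Ed n → ℝ) (k l : Fin n) : ℝ × Ed n → ℝ :=
  dx k a * dx l a + dx k b * dx l b

section Conservation

variable {n : ℕ} {a b : ℝ × Ed n → ℝ}

lemma SmoothDecay.massDensity (ha : SmoothDecay a) (hb : SmoothDecay b) :
    SmoothDecay (massDensity a b) := (ha.mul ha).add (hb.mul hb)

lemma SmoothDecay.momentum (ha : SmoothDecay a) (hb : SmoothDecay b) (k : Fin n) :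
    SmoothDecay (momentum a b k) := (ha.mul (hb.dx k)).sub (hb.mul (ha.dx k))

lemma SmoothDecay.stress (ha : SmoothDecay a) (hb : SmoothDecay b) (k l : Fin n) :
    SmoothDecay (stress a b k l) := ((ha.dx k).mul (ha.dx l)).add ((hb.dx k).mul (hb.dx l))

lemma dx_massDensity (ha : SmoothDecay a) (hb : SmoothDecay b) (k : Fin n) (p : ℝ × Ed n) :
    dx k (massDensity a b) p = 2 * (a p * dx k a p + b p * dx k b p) := by
  simp only [massDensity, dx_add, dx_mul, ha, hb, SmoothDecay.mul, Pi.add_apply, Pi.mul_apply]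
  ring

variable {W : ℝ × Ed n → ℝ}

lemma dt_massDensity (ha : SmoothDecay a) (hb : SmoothDecay b)
    (hta : ∀ p, dt a p = -(1 / 2) * ∑ l, dx l (dx l b) p + W p * b p)
    (htb : ∀ p, dt b p = (1 / 2) * ∑ l, dx l (dx l a) p - W p * a p) (p : ℝ × Ed n) :
    dt (massDensity a b) p = -∑ l, dx l (momentum a b l) p := by
  simp (maxDischargeDepth := 8) only [massDensity, momentum, dt_add, dt_mul, dx_sub, dx_mul, ha, hb,
    SmoothDecay.mul,
    SmoothDecay.dx, Pi.add_apply, Pi.mul_apply, Pi.sub_apply, hta, htb]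
  have : ∀ l, dx l a p * dx l b p + a p * dx l (dx l b) p
      - (dx l b p * dx l a p + b p * dx l (dx l a) p)
      = a p * dx l (dx l b) p - b p * dx l (dx l a) p := fun l => by ring
  simp only [this, Finset.sum_sub_distrib, ← Finset.mul_sum]
  ring

lemma dt_momentum (ha : SmoothDecay a) (hb : SmoothDecay b)
    (hW : ∀ t, Differentiable ℝ fun y => W (t, y))
    (hta : ∀ p, dt a p = -(1 / 2) * ∑ l, dx l (dx l b) p + W p * b p)
    (htb : ∀ p, dt b p = (1 / 2) * ∑ l, dx l (dx l a) p - W p * a p)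
    (k : Fin n) (t : ℝ) (x : Ed n) :
    dt (momentum a b k) (t, x) = ∑ l, (-dx l (stress a b l k) (t, x)
        + 1 / 4 * dx l (dx l (dx k (massDensity a b))) (t, x))
      - massDensity a b (t, x) * pdR k (fun y => W (t, y)) x := by
  have hdW : ∀ (f g : ℝ × Ed n → ℝ) (c : ℝ), SmoothDecay f → SmoothDecay g →
      fderiv ℝ (fun y => c * g (t, y) + W (t, y) * f (t, y)) x (EuclideanSpace.single k 1)
        = c * dx k g (t, x) + (pdR k (fun y => W (t, y)) x * f (t, x) + W (t, x) * dx k f (t, x)) :=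
      fun f g c hf hg => by
    have h1 := (hg.slice_differentiable t x).hasFDerivAt.const_mul c
    have h2 := ((hW t) x).hasFDerivAt.fun_mul (hf.slice_differentiable t x).hasFDerivAt
    rw [(h1.fun_add h2).fderiv, ← pdR_slice hg.differentiable, ← pdR_slice hf.differentiable]
    simp [pdR]
    ring
  have hsum : ∀ f : ℝ × Ed n → ℝ, SmoothDecay f → SmoothDecay (∑ l, dx l (dx l f)) :=
    fun f hf => SmoothDecay.sum fun l _ => (hf.dx l).dx l
  have hdsum : ∀ f : ℝ × Ed n → ℝ, SmoothDecay f →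
      dx k (∑ l, dx l (dx l f)) (t, x) = ∑ l, dx l (dx l (dx k f)) (t, x) := fun f hf => by
    have h := fderiv_sum (u := Finset.univ) fun l _ => ((hf.dx l).dx l).differentiable (t, x)
    have h' := congrArg (fun L => L (0, EuclideanSpace.single k 1)) h
    simp only [_root_.sum_apply] at h'
    refine h'.trans (Finset.sum_congr rfl fun l _ => ?_)
    have h1 := congrFun (dx_comm (hf.dx l) k l) (t, x)
    rw [dx_comm hf k l] at h1
    exact h1
  have hka : dx k (dt a) (t, x) = -(1 / 2) * ∑ l, dx l (dx l (dx k b)) (t, x)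
      + (pdR k (fun y => W (t, y)) x * b (t, x) + W (t, x) * dx k b (t, x)) := by
    rw [← pdR_slice ha.dt.differentiable, ← hdsum b hb, ← hdW b _ _ hb (hsum b hb), pdR]
    simp only [hta, Finset.sum_apply]
  have hkb : dx k (dt b) (t, x) = (1 / 2) * ∑ l, dx l (dx l (dx k a)) (t, x)
      - (pdR k (fun y => W (t, y)) x * a (t, x) + W (t, x) * dx k a (t, x)) := by
    have h := hdW (-a) _ (1 / 2) ha.neg (hsum a ha)
    have hna : dx k (-a) (t, x) = - dx k a (t, x) := by
      unfold dx; rw [fderiv_neg]; rfl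
    rw [hdsum a ha, hna] at h
    rw [← pdR_slice hb.dt.differentiable, pdR]
    simp only [htb]
    simp only [Pi.neg_apply, Finset.sum_apply, mul_neg] at h
    simp only [sub_eq_add_neg, h]
    ring
  have e1 : dx k (massDensity a b) = (a * dx k a + b * dx k b) + (a * dx k a + b * dx k b) := by
    funext p
    rw [dx_massDensity ha hb]
    simp only [Pi.add_apply, Pi.mul_apply]; ring
  have hc : ∀ l, -dx l (stress a b l k) (t, x)
      + 1 / 4 * dx l (dx l (dx k (massDensity a b))) (t, x)
      = (1 / 2) * (a (t, x) * dx l (dx l (dx k a)) (t, x)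
        + b (t, x) * dx l (dx l (dx k b)) (t, x)
        - dx k a (t, x) * dx l (dx l a) (t, x) - dx k b (t, x) * dx l (dx l b) (t, x)) := by
    intro l
    rw [e1]
    simp (maxDischargeDepth := 8) only [stress, dx_add, dx_mul, ha, hb, SmoothDecay.mul,
      SmoothDecay.add,
      SmoothDecay.dx, Pi.add_apply, Pi.mul_apply]
    ring
  simp only [hc, ← Finset.mul_sum, Finset.sum_sub_distrib, Finset.sum_add_distrib]
  simp (maxDischargeDepth := 8) only [momentum, dt_sub, dt_mul, ha, hb, SmoothDecay.mul,
    SmoothDecay.dx, Pi.sub_apply,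
    Pi.add_apply, Pi.mul_apply, dt_dx, hka, hkb, hta, htb, massDensity]
  ring

end Conservation

section Potential

variable {n : ℕ} {V f : Ed n → ℝ}

lemma integral_prod_nonneg_of_add_swap_nonneg {φ : Ed n × Ed n → ℝ} (hφ : Integrable φ)
    (h : ∀ p, 0 ≤ φ p + φ p.swap) : 0 ≤ ∫ p, φ p := by
  have h1 : ∫ p : Ed n × Ed n, φ p.swap = ∫ p, φ p := integral_prod_swap φ
  have h2 : Integrable fun p : Ed n × Ed n => φ p.swap := hφ.swap
  have h3 : 0 ≤ ∫ p, (φ p + φ p.swap) := integral_nonneg h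
  rw [integral_add hφ h2, h1] at h3
  linarith

lemma BddKernel.conv (hV : BddKernel V) (hf : Integrable f) :
    BddKernel fun x => ∫ y, V (x - y) * f y := by
  obtain ⟨hc, C, hC⟩ := hV
  have hb : ∀ x, ∀ᵐ y, ‖V (x - y) * f y‖ ≤ C * ‖f y‖ := fun x => ae_of_all _ fun y => by
    rw [norm_mul]; gcongr; exact hC _
  refine ⟨continuous_of_dominated (bound := fun y => C * ‖f y‖) (fun x => ?_) hb
    (hf.norm.const_mul C) (ae_of_all _ fun y => ?_), ∫ y, C * ‖f y‖, fun x => ?_⟩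
  · exact (hc.comp (by fun_prop)).aestronglyMeasurable.mul hf.1
  · exact (hc.comp (by fun_prop : Continuous fun x : Ed n => x - y)).mul continuous_const
  · exact norm_integral_le_of_norm_le (hf.norm.const_mul C) (hb x)

lemma hasFDerivAt_conv (hV : ContDiff ℝ 1 V) {C C' : ℝ} (hC : ∀ z, |V z| ≤ C)
    (hC' : ∀ z, ‖fderiv ℝ V z‖ ≤ C') (hf : Integrable f) (x : Ed n) :
    HasFDerivAt (fun x => ∫ y, V (x - y) * f y) (∫ y, f y • fderiv ℝ V (x - y)) x := by
  refine hasFDerivAt_integral_of_dominated_of_fderiv_le (s := Set.univ)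
    (bound := fun y => C' * ‖f y‖) (F' := fun x y => f y • fderiv ℝ V (x - y)) univ_mem
    (Eventually.of_forall fun x => ?_) ?_ ?_ (ae_of_all _ fun y x _ => ?_)
    (hf.norm.const_mul C') (ae_of_all _ fun y x _ => ?_)
  · exact (hV.continuous.comp (by fun_prop)).aestronglyMeasurable.mul hf.1
  · exact hf.bdd_mul (hV.continuous.comp (by fun_prop)).aestronglyMeasurable
      (ae_of_all _ fun y => hC _)
  · exact hf.1.smul ((hV.continuous_fderiv (by simp)).comp (by fun_prop)).aestronglyMeasurable
  · rw [norm_smul, mul_comm]; gcongr; exact hC' _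
  · have h := ((hV.differentiable (by simp)) (x - y)).hasFDerivAt.comp x
      ((hasFDerivAt_id x).sub_const y)
    exact h.mul_const (f y)

lemma pdR_conv (hV : ContDiff ℝ 1 V) {C C' : ℝ} (hC : ∀ z, |V z| ≤ C)
    (hC' : ∀ z, ‖fderiv ℝ V z‖ ≤ C') (hf : Integrable f) (k : Fin n) (x : Ed n) :
    pdR k (fun x => ∫ y, V (x - y) * f y) x = ∫ y, pdR k V (x - y) * f y := by
  rw [pdR, (hasFDerivAt_conv hV hC hC' hf x).fderiv, ContinuousLinearMap.integral_apply]
  · simp [pdR, mul_comm]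
  · refine (hf.norm.const_mul C').mono'
      (hf.1.smul ((hV.continuous_fderiv (by simp)).comp (by fun_prop)).aestronglyMeasurable)
      (ae_of_all _ fun y => ?_)
    rw [norm_smul, mul_comm]; gcongr; exact hC' _

lemma bddKernel_pdR (hV : ContDiff ℝ 1 V) {C' : ℝ} (hC' : ∀ z, ‖fderiv ℝ V z‖ ≤ C')
    (k : Fin n) : BddKernel (pdR k V) := by
  refine ⟨(hV.continuous_fderiv (by simp)).clm_apply continuous_const, C', fun z => ?_⟩
  have h := (fderiv ℝ V z).le_opNorm (EuclideanSpace.single k 1)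
  simp only [PiLp.norm_single, norm_one, mul_one] at h
  exact h.trans (hC' z)

lemma exists_pdR_radial {v : ℝ → ℝ} (hV : Differentiable ℝ V) (hrad : ∀ x, V x = v ‖x‖)
    (hvdiff : ∀ r : ℝ, 0 < r → DifferentiableAt ℝ v r) (hv' : ∀ r : ℝ, 0 < r → deriv v r ≤ 0) :
    ∃ c : Ed n → ℝ, (∀ z, c z ≤ 0) ∧ (∀ z, c (-z) = c z) ∧
      ∀ k z, pdR k V z = c z * z k := by
  refine ⟨fun z => deriv v ‖z‖ / ‖z‖, fun z => ?_, fun z => by simp, fun k z => ?_⟩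
  · rcases eq_or_ne z 0 with rfl | hz
    · simp
    · exact div_nonpos_of_nonpos_of_nonneg (hv' _ (norm_pos_iff.2 hz)) (norm_nonneg z)
  · rcases eq_or_ne z 0 with rfl | hz
    · have h1 : (fun x => V (-x)) = V := by funext x; simp [hrad]
      have h2 := ((hV (-0)).hasFDerivAt.comp (0 : Ed n) (hasFDerivAt_id (0 : Ed n)).neg).fderiv
      have h3 : fderiv ℝ (fun x => V (-x)) 0 = _ := h2
      rw [h1, neg_zero] at h3
      have h4 : pdR k V 0 = - pdR k V 0 := by
        conv_lhs => rw [pdR, h3]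
        simp [pdR]
      simp; linarith
    · have hp := norm_pos_iff.2 hz
      have hN : HasFDerivAt (fun x : Ed n => ‖x‖) ((1 / (2 * ‖z‖)) • (2 • innerSL ℝ z)) z := by
        have h := (hasStrictFDerivAt_norm_sq z).hasFDerivAt.sqrt (by positivity)
        simpa [Real.sqrt_sq (norm_nonneg _)] using h
      have h1 : HasFDerivAt (fun x : Ed n => v ‖x‖) _ z :=
        (hvdiff _ hp).hasDerivAt.comp_hasFDerivAt z hN
      have h2 : V = fun x => v ‖x‖ := funext hrad
      have h3 : inner ℝ z (EuclideanSpace.single k 1) = z k := by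
        rw [← sum_coord_mul]; simp
      rw [pdR, h2, h1.fderiv]
      simp [h3]
      field_simp

lemma sum_interaction_conv_nonpos {ε : ℝ} (hε : 0 < ε) {c : Ed n → ℝ} (hc : ∀ z, c z ≤ 0)
    (hceven : ∀ z, c (-z) = c z) (hVc : ∀ k z, pdR k V z = c z * z k)
    (hV : ∀ k, BddKernel (pdR k V)) (hf : Integrable f) (hf0 : ∀ x, 0 ≤ f x) :
    ∑ k, interaction (gradKernel ε k) f (fun y => f y * ∫ z, pdR k V (y - z) * f z) ≤ 0 := by
  have hK := fun k : Fin n => bddKernel_gradKernel (n := n) hε k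
  have hg : ∀ k, Integrable (fun y => f y * ∫ z, pdR k V (y - z) * f z) := fun k => by
    obtain ⟨h1, C, hC⟩ := (hV k).conv hf
    simp_rw [mul_comm (f _)]
    exact hf.bdd_mul h1.aestronglyMeasurable (ae_of_all _ hC)
  have hint : ∀ x, ∀ k, Integrable fun p : Ed n × Ed n =>
      f p.1 * gradKernel ε k (p.1 - x) * (pdR k V (p.1 - p.2) * f p.2) := fun x k => by
    obtain ⟨h1, C, hC⟩ := hK k
    obtain ⟨h2, D, hD⟩ := hV k
    have h := (hf.mul_prod hf).bdd_mul
      (f := fun p : Ed n × Ed n => gradKernel ε k (p.1 - x) * pdR k V (p.1 - p.2)) (c := C * D)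
      ((h1.comp (by fun_prop)).mul (h2.comp (by fun_prop))).aestronglyMeasurable
      (ae_of_all _ fun p => by
        rw [norm_mul]
        exact mul_le_mul (hC _) (hD _) (norm_nonneg _) ((abs_nonneg _).trans (hC 0)))
    exact h.congr (ae_of_all _ fun p => by ring)
  have hx : ∀ x, ∑ k, ∫ y, gradKernel ε k (y - x) * (f y * ∫ z, pdR k V (y - z) * f z) ≤ 0 := by
    intro x
    have h1 : ∀ k, ∫ y, gradKernel ε k (y - x) * (f y * ∫ z, pdR k V (y - z) * f z)
        = ∫ p : Ed n × Ed n,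
          f p.1 * gradKernel ε k (p.1 - x) * (pdR k V (p.1 - p.2) * f p.2) := fun k => by
      rw [Measure.volume_eq_prod, integral_prod _ (hint x k)]
      refine integral_congr_ae (ae_of_all _ fun y => ?_)
      simp only
      rw [integral_const_mul]
      ring
    simp_rw [h1]
    rw [← integral_finsetSum _ fun k _ => hint x k, ← neg_nonneg, ← integral_neg]
    refine integral_prod_nonneg_of_add_swap_nonneg
      (integrable_finsetSum _ fun k _ => hint x k).neg fun p => ?_
    have h2 := gradKernel_monotone hε (p.1 - x) (p.2 - x)
    rw [sub_sub_sub_cancel_right] at h2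
    have h3 : -(∑ k, f p.1 * gradKernel ε k (p.1 - x) * (pdR k V (p.1 - p.2) * f p.2))
        + -(∑ k, f p.swap.1 * gradKernel ε k (p.swap.1 - x)
          * (pdR k V (p.swap.1 - p.swap.2) * f p.swap.2))
        = f p.1 * f p.2 * (-c (p.1 - p.2)) * ∑ k, (gradKernel ε k (p.1 - x)
          - gradKernel ε k (p.2 - x)) * (p.1 - p.2) k := by
      rw [Finset.mul_sum, ← neg_add, ← Finset.sum_add_distrib, ← Finset.sum_neg_distrib]
      refine Finset.sum_congr rfl fun k _ => ?_
      simp only [hVc, Prod.fst_swap, Prod.snd_swap]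
      rw [← neg_sub p.1 p.2, hceven]
      simp only [PiLp.neg_apply]
      ring
    rw [h3]
    exact mul_nonneg (mul_nonneg (mul_nonneg (hf0 _) (hf0 _)) (neg_nonneg.2 (hc _))) h2
  have hint2 : ∀ k, Integrable fun x =>
      f x * ∫ y, gradKernel ε k (y - x) * (f y * ∫ z, pdR k V (y - z) * f z) := fun k => by
    have h := ((hK k).integrable_interaction hf (hg k)).integral_prod_left
    refine h.congr (ae_of_all _ fun x => ?_)
    simp only [mul_assoc, integral_const_mul]
  rw [Finset.sum_congr rfl fun k _ => interaction_eq_iterated (hK k) hf (hg k),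
    ← integral_finsetSum _ fun k _ => hint2 k]
  refine integral_nonpos fun x => ?_
  simp only [← Finset.mul_sum, Pi.zero_apply]
  exact mul_nonpos_of_nonneg_of_nonpos (hf0 x) (hx x)

end Potential

/-- The interaction Morawetz action with the gradient of `regNorm ε` as kernel. -/
def morawetzAction {n : ℕ} (ε : ℝ) (a b : ℝ × Ed n → ℝ) (t : ℝ) : ℝ :=
  ∑ k, interaction (gradKernel ε k) (fun x => massDensity a b (t, x))
    (fun y => momentum a b k (t, y))

/-- The quadratic Morawetz form, regularised at scale `ε`. -/
def morawetzForm {n : ℕ} (ε : ℝ) (ρ : ℝ × Ed n → ℝ) (t : ℝ) : ℝ :=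
  1 / 2 * ∑ k, ∑ l, interaction (hessKernel ε k k) (fun x => dx l ρ (t, x))
    (fun y => dx l ρ (t, y))

section Morawetz

variable {n : ℕ} {ε : ℝ} {f g a b : ℝ × Ed n → ℝ}

lemma interaction_dx_right (hε : 0 < ε) (hf : SmoothDecay f) (hg : SmoothDecay g) (k l : Fin n)
    (t : ℝ) : interaction (gradKernel ε k) (fun x => f (t, x)) (fun y => dx l g (t, y))
      = -interaction (hessKernel ε k l) (fun x => f (t, x)) (fun y => g (t, y)) := by
  have hpd : pdR l (fun y => g (t, y)) = fun y => dx l g (t, y) :=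
    funext fun y => pdR_slice hg.differentiable l t y
  have h := interaction_pdR_right l (bddKernel_gradKernel hε k) (differentiable_gradKernel hε k)
    (by rw [pdR_gradKernel hε]; exact bddKernel_hessKernel hε k l) (hf.slice_integrable t)
    (hg.slice_integrable t) (hg.slice_differentiable t)
    (by rw [hpd]; exact (hg.dx l).slice_integrable t)
  rwa [hpd, pdR_gradKernel hε] at h

lemma interaction_dx_left (hε : 0 < ε) (hf : SmoothDecay f) (hg : SmoothDecay g) (k l : Fin n)
    (t : ℝ) : interaction (gradKernel ε k) (fun x => dx l f (t, x)) (fun y => g (t, y))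
      = interaction (hessKernel ε k l) (fun x => f (t, x)) (fun y => g (t, y)) := by
  have hpd : pdR l (fun y => f (t, y)) = fun y => dx l f (t, y) :=
    funext fun y => pdR_slice hf.differentiable l t y
  have h := interaction_pdR_left l (bddKernel_gradKernel hε k) (differentiable_gradKernel hε k)
    (by rw [pdR_gradKernel hε]; exact bddKernel_hessKernel hε k l) (hf.slice_integrable t)
    (hg.slice_integrable t) (hf.slice_differentiable t)
    (by rw [hpd]; exact (hf.dx l).slice_integrable t)
  rwa [hpd, pdR_gradKernel hε] at h

lemma interaction_dispersive (hε : 0 < ε) (hf : SmoothDecay f) (k l : Fin n) (t : ℝ) :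
    interaction (gradKernel ε k) (fun x => f (t, x)) (fun y => dx l (dx l (dx k f)) (t, y))
      = 2 * interaction (hessKernel ε k k) (fun x => dx l f (t, x)) (fun y => dx l f (t, y))
        - interaction (hessKernel ε k l) (fun x => dx l f (t, x)) (fun y => dx k f (t, y)) := by
  have h1 := interaction_dx_right hε hf ((hf.dx k).dx l) k l t
  have h2 := interaction_dx_left hε hf ((hf.dx k).dx l) k l t
  have h3 := interaction_dx_right hε (hf.dx l) (hf.dx k) k l t
  have h4 := interaction_dx_right hε (hf.dx l) (hf.dx l) k k t
  rw [dx_comm hf k l] at h4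
  linarith

lemma interaction_kinetic_nonneg (hε : 0 < ε) (ha : SmoothDecay a) (hb : SmoothDecay b) (t : ℝ) :
    0 ≤ ∑ k, ∑ l,
      (interaction (hessKernel ε k l) (fun x => massDensity a b (t, x))
          (fun y => stress a b l k (t, y))
        - interaction (hessKernel ε k l) (fun x => momentum a b l (t, x))
          (fun y => momentum a b k (t, y))
        - 1 / 4 * interaction (hessKernel ε k l) (fun x => dx l (massDensity a b) (t, x))
          (fun y => dx k (massDensity a b) (t, y))) := by
  have hρ := ha.massDensity hb
  have hi : ∀ (k l : Fin n) {f g : ℝ × Ed n → ℝ}, SmoothDecay f → SmoothDecay g →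
      Integrable fun p : Ed n × Ed n => f (t, p.1) * hessKernel ε k l (p.2 - p.1) * g (t, p.2) :=
    fun k l f g hf hg => (bddKernel_hessKernel hε k l).integrable_interaction
      (hf.slice_integrable t) (hg.slice_integrable t)
  have h1 := fun k l : Fin n => hi k l hρ (ha.stress hb l k)
  have h2 := fun k l : Fin n => hi k l (ha.momentum hb l) (ha.momentum hb k)
  have h3 := fun k l : Fin n => (hi k l (hρ.dx l) (hρ.dx k)).const_mul (1 / 4)
  let ψ : Fin n → Fin n → Ed n × Ed n → ℝ := fun k l p =>
    massDensity a b (t, p.1) * hessKernel ε k l (p.2 - p.1) * stress a b l k (t, p.2)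
      - momentum a b l (t, p.1) * hessKernel ε k l (p.2 - p.1) * momentum a b k (t, p.2)
      - 1 / 4 * (dx l (massDensity a b) (t, p.1) * hessKernel ε k l (p.2 - p.1)
        * dx k (massDensity a b) (t, p.2))
  have h4 : ∀ k l, Integrable (ψ k l) := fun k l => ((h1 k l).sub (h2 k l)).sub (h3 k l)
  have h5 : ∀ k, Integrable fun p => ∑ l, ψ k l p :=
    fun k => integrable_finsetSum Finset.univ fun l _ => h4 k l
  have e1 : ∀ k l : Fin n, interaction (hessKernel ε k l) (fun x => massDensity a b (t, x))
          (fun y => stress a b l k (t, y))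
        - interaction (hessKernel ε k l) (fun x => momentum a b l (t, x))
          (fun y => momentum a b k (t, y))
        - 1 / 4 * interaction (hessKernel ε k l) (fun x => dx l (massDensity a b) (t, x))
          (fun y => dx k (massDensity a b) (t, y)) = ∫ p, ψ k l p := fun k l =>
    ((integral_sub ((h1 k l).sub (h2 k l)) (h3 k l)).trans (congrArg₂ _
      (integral_sub (h1 k l) (h2 k l)) (integral_const_mul _ _))).symm
  simp_rw [e1]
  rw [← Finset.sum_congr rfl fun k _ => integral_finsetSum Finset.univ fun l _ => h4 k l,
    ← integral_finsetSum Finset.univ fun k _ => h5 k]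
  refine integral_prod_nonneg_of_add_swap_nonneg
    (integrable_finsetSum Finset.univ fun k _ => h5 k) fun p => ?_
  obtain ⟨x, y⟩ := p
  have hX := hessKernel_quadratic_nonneg (y - x) hε fun l =>
    dx l a (t, x) * a (t, y) - dx l b (t, x) * b (t, y)
      - (a (t, x) * dx l a (t, y) - b (t, x) * dx l b (t, y))
  have hY := hessKernel_quadratic_nonneg (y - x) hε fun l =>
    dx l a (t, x) * b (t, y) + dx l b (t, x) * a (t, y)
      - (a (t, x) * dx l b (t, y) + b (t, x) * dx l a (t, y))
  refine (add_nonneg hX hY).trans_eq ?_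
  simp only [ψ, ← Finset.sum_add_distrib, Prod.swap_prod_mk]
  refine Finset.sum_congr rfl fun k _ => Finset.sum_congr rfl fun l _ => ?_
  simp only [dx_massDensity ha hb]
  simp only [stress, momentum, massDensity, Pi.add_apply, Pi.sub_apply,
    Pi.mul_apply, ← neg_sub y x, hessKernel_neg]
  ring

variable {V : Ed n → ℝ}

lemma hasDerivAt_morawetzAction (hε : 0 < ε) (ha : SmoothDecay a) (hb : SmoothDecay b) (t : ℝ) :
    HasDerivAt (morawetzAction ε a b)
      (∑ k, (interaction (gradKernel ε k) (fun x => dt (massDensity a b) (t, x))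
          (fun y => momentum a b k (t, y))
        + interaction (gradKernel ε k) (fun x => massDensity a b (t, x))
          (fun y => dt (momentum a b k) (t, y)))) t :=
  HasDerivAt.fun_sum fun k _ =>
    hasDerivAt_interaction (bddKernel_gradKernel hε k) (ha.massDensity hb) (ha.momentum hb k) t

lemma continuous_morawetzForm (hε : 0 < ε) (hf : SmoothDecay f) :
    Continuous (morawetzForm ε f) :=
  continuous_const.mul <| continuous_finsetSum _ fun k _ => continuous_finsetSum _ fun l _ =>
    continuous_iff_continuousAt.2 fun t => (hasDerivAt_interaction (bddKernel_hessKernel hε k k)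
      (hf.dx l) (hf.dx l) t).continuousAt

/-- Monotonicity of the Morawetz action along the Hartree flow. -/
lemma morawetzForm_le_deriv (hε : 0 < ε) (ha : SmoothDecay a) (hb : SmoothDecay b)
    (hV : ContDiff ℝ 1 V) {C C' : ℝ} (hC : ∀ z, |V z| ≤ C) (hC' : ∀ z, ‖fderiv ℝ V z‖ ≤ C')
    {c : Ed n → ℝ} (hc : ∀ z, c z ≤ 0) (hceven : ∀ z, c (-z) = c z)
    (hVc : ∀ k z, pdR k V z = c z * z k)
    (hta : ∀ p, dt a p = -(1 / 2) * ∑ l, dx l (dx l b) p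
      + (∫ y, V (p.2 - y) * massDensity a b (p.1, y)) * b p)
    (htb : ∀ p, dt b p = (1 / 2) * ∑ l, dx l (dx l a) p
      - (∫ y, V (p.2 - y) * massDensity a b (p.1, y)) * a p) (t : ℝ) :
    morawetzForm ε (massDensity a b) t ≤
      ∑ k, (interaction (gradKernel ε k) (fun x => dt (massDensity a b) (t, x))
          (fun y => momentum a b k (t, y))
        + interaction (gradKernel ε k) (fun x => massDensity a b (t, x))
          (fun y => dt (momentum a b k) (t, y))) := by
  have hρ := ha.massDensity hb
  have hK := fun k : Fin n => bddKernel_gradKernel (n := n) hε k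
  have hρi := fun t => hρ.slice_integrable t
  have hWd : ∀ t, Differentiable ℝ fun x => ∫ y, V (x - y) * massDensity a b (t, y) :=
    fun t x => (hasFDerivAt_conv hV hC hC' (hρi t) x).differentiableAt
  have e1 : ∀ k, interaction (gradKernel ε k) (fun x => dt (massDensity a b) (t, x))
      (fun y => momentum a b k (t, y)) = -∑ l, interaction (hessKernel ε k l)
        (fun x => momentum a b l (t, x)) (fun y => momentum a b k (t, y)) := fun k => by
    simp_rw [dt_massDensity ha hb hta htb]
    rw [interaction_neg_sum_left (hK k) ((ha.momentum hb k).slice_integrable t)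
      fun l _ => ((ha.momentum hb l).dx l).slice_integrable t]
    simp_rw [fun l => interaction_dx_left hε (ha.momentum hb l) (ha.momentum hb k) k l t]
  have hVi : ∀ k, Integrable fun y => massDensity a b (t, y)
      * ∫ z, pdR k V (y - z) * massDensity a b (t, z) := fun k => by
    obtain ⟨h1, D, hD⟩ := (bddKernel_pdR hV hC' k).conv (hρi t)
    simp_rw [mul_comm (massDensity a b _)]
    exact (hρi t).bdd_mul h1.aestronglyMeasurable (ae_of_all _ hD)
  have e2 : ∀ k, interaction (gradKernel ε k) (fun x => massDensity a b (t, x))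
      (fun y => dt (momentum a b k) (t, y)) = ∑ l, (interaction (hessKernel ε k l)
        (fun x => massDensity a b (t, x)) (fun y => stress a b l k (t, y))
        + 1 / 4 * (2 * interaction (hessKernel ε k k) (fun x => dx l (massDensity a b) (t, x))
          (fun y => dx l (massDensity a b) (t, y))
        - interaction (hessKernel ε k l) (fun x => dx l (massDensity a b) (t, x))
          (fun y => dx k (massDensity a b) (t, y))))
      - interaction (gradKernel ε k) (fun x => massDensity a b (t, x))
        (fun y => massDensity a b (t, y)
          * ∫ z, pdR k V (y - z) * massDensity a b (t, z)) := fun k => by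
    have hS : ∀ l, Integrable fun y => -dx l (stress a b l k) (t, y) :=
      fun l => (((ha.stress hb l k).dx l).slice_integrable t).neg
    have hD : ∀ l, Integrable fun y => 1 / 4 * dx l (dx l (dx k (massDensity a b))) (t, y) :=
      fun l => ((((hρ.dx k).dx l).dx l).slice_integrable t).const_mul (1 / 4)
    have hSD : ∀ l, Integrable fun y => -dx l (stress a b l k) (t, y)
        + 1 / 4 * dx l (dx l (dx k (massDensity a b))) (t, y) := fun l => (hS l).add (hD l)
    have hm : (fun y => dt (momentum a b k) (t, y)) = fun y => (∑ l, (-dx l (stress a b l k) (t, y)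
        + 1 / 4 * dx l (dx l (dx k (massDensity a b))) (t, y))) + -(massDensity a b (t, y)
          * ∫ z, pdR k V (y - z) * massDensity a b (t, z)) := funext fun y => by
      rw [dt_momentum ha hb hWd hta htb, ← pdR_conv hV hC hC' (hρi t), sub_eq_add_neg]
    rw [hm, interaction_add_right (hK k) (hρi t) (integrable_finsetSum _ fun l _ => hSD l)
      (g' := fun y => -(massDensity a b (t, y)
          * ∫ z, pdR k V (y - z) * massDensity a b (t, z))) (hVi k).neg,
        interaction_neg_right, interaction_sum_right (hK k) (hρi t) fun l _ => hSD l,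
      ← sub_eq_add_neg]
    congr 1
    refine Finset.sum_congr rfl fun l _ => ?_
    rw [interaction_add_right (hK k) (hρi t) (hS l) (hD l), interaction_neg_right,
      interaction_const_mul_right, interaction_dx_right hε hρ (ha.stress hb l k),
      interaction_dispersive hε hρ]
    ring
  have h0 := interaction_kinetic_nonneg hε ha hb t
  have hn := sum_interaction_conv_nonpos hε hc hceven hVc (bddKernel_pdR hV hC') (hρi t)
    fun x => add_nonneg (mul_self_nonneg _) (mul_self_nonneg _)
  simp only [e1, e2, morawetzForm]
  simp only [Finset.sum_add_distrib, Finset.sum_sub_distrib, Finset.sum_neg_distrib,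
    ← Finset.mul_sum] at h0 ⊢
  linarith

end Morawetz

section ActionBound

variable {n : ℕ} {ε : ℝ} {a b : ℝ × Ed n → ℝ}

lemma integral_sqrt_mul_sqrt_le {α : Type*} [MeasurableSpace α] {μ : Measure α} {f g : α → ℝ}
    (hf : Integrable f μ) (hg : Integrable g μ) (hf0 : ∀ x, 0 ≤ f x) (hg0 : ∀ x, 0 ≤ g x) :
    Integrable (fun x => √(f x) * √(g x)) μ ∧
      ∫ x, √(f x) * √(g x) ∂μ ≤ (∫ x, f x ∂μ) ^ ((1 : ℝ) / 2) * (∫ x, g x ∂μ) ^ ((1 : ℝ) / 2) := by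
  have hm : ∀ {h : α → ℝ}, Integrable h μ → AEStronglyMeasurable (fun x => √(h x)) μ :=
    fun hh => Real.continuous_sqrt.comp_aestronglyMeasurable hh.aestronglyMeasurable
  have hL : ∀ {h : α → ℝ}, Integrable h μ → (∀ x, 0 ≤ h x) →
      MemLp (fun x => √(h x)) (ENNReal.ofReal 2) μ := fun hh hh0 => by
    rw [ENNReal.ofReal_ofNat, memLp_two_iff_integrable_sq (hm hh)]
    exact hh.congr (ae_of_all _ fun x => (Real.sq_sqrt (hh0 x)).symm)
  refine ⟨?_, ?_⟩
  · refine (hf.add hg).mono' ((hm hf).mul (hm hg)) (ae_of_all _ fun x => ?_)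
    rw [Real.norm_of_nonneg (by positivity)]
    have h1 := Real.sq_sqrt (hf0 x)
    have h2 := Real.sq_sqrt (hg0 x)
    simp only [Pi.add_apply]
    nlinarith [sq_nonneg (√(f x) - √(g x)), hf0 x, hg0 x]
  · have h := integral_mul_le_Lp_mul_Lq_of_nonneg (μ := μ) Real.HolderConjugate.two_two
      (ae_of_all _ fun x => Real.sqrt_nonneg (f x)) (ae_of_all _ fun x => Real.sqrt_nonneg (g x))
      (hL hf hf0) (hL hg hg0)
    simpa only [Real.rpow_two, Real.sq_sqrt (hf0 _), Real.sq_sqrt (hg0 _)] using h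

lemma abs_morawetzAction_le (hε : 0 < ε) (ha : SmoothDecay a) (hb : SmoothDecay b) (t : ℝ) :
    |morawetzAction ε a b t| ≤ ((∫ x, massDensity a b (t, x)) ^ ((1 : ℝ) / 2)) ^ 3
      * (∫ x, ∑ k, stress a b k k (t, x)) ^ ((1 : ℝ) / 2) := by
  have hρi := (ha.massDensity hb).slice_integrable t
  have hρ0 : ∀ x, 0 ≤ massDensity a b (t, x) :=
    fun x => add_nonneg (mul_self_nonneg _) (mul_self_nonneg _)
  have hei : Integrable fun x => ∑ k, stress a b k k (t, x) :=
    integrable_finsetSum _ fun k _ => (ha.stress hb k k).slice_integrable t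
  have he0 : ∀ x, 0 ≤ ∑ k, stress a b k k (t, x) := fun x =>
    Finset.sum_nonneg fun k _ => add_nonneg (mul_self_nonneg _) (mul_self_nonneg _)
  obtain ⟨hi, hle⟩ := integral_sqrt_mul_sqrt_le hρi hei hρ0 he0
  have hK := fun k : Fin n => (bddKernel_gradKernel hε k).integrable_interaction hρi
    ((ha.momentum hb k).slice_integrable t)
  have hsum : morawetzAction ε a b t = ∫ p : Ed n × Ed n, ∑ k, massDensity a b (t, p.1)
      * gradKernel ε k (p.2 - p.1) * momentum a b k (t, p.2) :=
    (integral_finsetSum _ fun k _ => hK k).symm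
  have hpt : ∀ p : Ed n × Ed n, ‖∑ k, massDensity a b (t, p.1)
      * gradKernel ε k (p.2 - p.1) * momentum a b k (t, p.2)‖ ≤ massDensity a b (t, p.1)
        * (√(massDensity a b (t, p.2)) * √(∑ k, stress a b k k (t, p.2))) := fun p => by
    simp_rw [mul_assoc]
    rw [← Finset.mul_sum, norm_mul, Real.norm_of_nonneg (hρ0 _)]
    refine mul_le_mul_of_nonneg_left ?_ (hρ0 _)
    rw [← Real.sqrt_mul (hρ0 _)]
    refine Real.abs_le_sqrt ((Finset.sum_mul_sq_le_sq_mul_sq _ _ _).trans ?_)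
    refine (mul_le_of_le_one_left (Finset.sum_nonneg fun k _ => sq_nonneg _)
      (sum_gradKernel_sq_le _ hε)).trans ?_
    rw [Finset.mul_sum]
    refine Finset.sum_le_sum fun k _ => ?_
    simp only [momentum, massDensity, stress, Pi.add_apply, Pi.sub_apply, Pi.mul_apply]
    nlinarith [sq_nonneg (a (t, p.2) * dx k a (t, p.2) + b (t, p.2) * dx k b (t, p.2))]
  have h := norm_integral_le_of_norm_le (hρi.mul_prod hi) (ae_of_all _ hpt)
  rw [hsum, ← Real.norm_eq_abs]
  refine h.trans ?_
  rw [integral_prod_mul (fun x => massDensity a b (t, x))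
    fun y => √(massDensity a b (t, y)) * √(∑ k, stress a b k k (t, y))]
  have hI : 0 ≤ ∫ x, massDensity a b (t, x) := integral_nonneg hρ0
  have h3 : ((∫ x, massDensity a b (t, x)) ^ ((1 : ℝ) / 2)) ^ 3
      = (∫ x, massDensity a b (t, x)) * (∫ x, massDensity a b (t, x)) ^ ((1 : ℝ) / 2) := by
    rw [← Real.sqrt_eq_rpow, pow_succ, Real.sq_sqrt hI]
  rw [h3, mul_assoc]
  exact mul_le_mul_of_nonneg_left hle hI

lemma integral_le_of_le_deriv_of_abs_le {M M' Q : ℝ → ℝ} (hM : ∀ t, HasDerivAt M (M' t) t)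
    (hQ : Continuous Q) (hQM : ∀ t, Q t ≤ M' t) {D : ℝ} (hD : ∀ t, |M t| ≤ D) {T : ℝ}
    (hT : 0 ≤ T) : ∫ t in (-T)..T, Q t ≤ 2 * D := by
  have h := intervalIntegral.integral_le_sub_of_hasDeriv_right_of_le (neg_le_self hT)
    (fun t _ => (hM t).continuousAt.continuousWithinAt) (fun t _ => (hM t).hasDerivWithinAt)
    (hQ.integrableOn_Icc) (fun t _ => hQM t)
  have h1 := abs_le.1 (hD T)
  have h2 := abs_le.1 (hD (-T))
  linarith

end ActionBound

section Limit

variable {n : ℕ} {f : ℝ × Ed n → ℝ}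

lemma integrable_indicator_inv_norm (hn : 2 ≤ n) :
    Integrable fun z : Ed n => (Set.Iio (1 : ℝ)).indicator (fun r => r⁻¹) ‖z‖ := by
  have : Nontrivial (Ed n) := by
    have : Nonempty (Fin n) := ⟨⟨0, by omega⟩⟩
    infer_instance
  rw [integrable_fun_norm_addHaar (volume : Measure (Ed n))
    (f := (Set.Iio (1 : ℝ)).indicator fun r => r⁻¹), finrank_euclideanSpace, Fintype.card_fin]
  have h1 : IntegrableOn ((Set.Iio (1 : ℝ)).indicator fun _ => (1 : ℝ)) (Set.Ioi 0) := by
    rw [IntegrableOn, integrable_indicator_iff measurableSet_Iio, IntegrableOn,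
      Measure.restrict_restrict measurableSet_Iio, Set.Iio_inter_Ioi]
    exact integrableOn_const (by simp)
  refine h1.mono' ?_ ?_
  · exact ((measurable_id.pow_const _).smul
      (measurable_inv.indicator measurableSet_Iio)).aestronglyMeasurable
  · refine (ae_restrict_iff' measurableSet_Ioi).2 (ae_of_all _ fun r hr => ?_)
    have hr0 : (0 : ℝ) < r := hr
    by_cases h : r ∈ Set.Iio (1 : ℝ)
    · rw [Set.indicator_of_mem h, Set.indicator_of_mem h, smul_eq_mul,
        Real.norm_of_nonneg (by positivity)]
      obtain ⟨m, rfl⟩ := Nat.exists_eq_add_of_le hn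
      have : r ^ (2 + m - 1) * r⁻¹ = r ^ m := by
        rw [show 2 + m - 1 = m + 1 by omega, pow_succ, mul_assoc, mul_inv_cancel₀ hr0.ne', mul_one]
      rw [this]
      exact pow_le_one₀ hr0.le (le_of_lt h)
    · rw [Set.indicator_of_notMem h, Set.indicator_of_notMem h]
      simp

lemma integrable_inv_norm_mul_decayWeight (hn : 2 ≤ n) :
    Integrable fun p : Ed n × Ed n => ‖p.1 - p.2‖⁻¹ * (decayWeight p.1 * decayWeight p.2) := by
  have hw := integrable_decayWeight (n := n)
  have h1 := hw.convolution_integrand (ContinuousLinearMap.mul ℝ ℝ)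
    (integrable_indicator_inv_norm hn)
  have h2 := hw.mul_prod hw
  refine (h1.add h2).mono' ?_ (ae_of_all _ fun p => ?_)
  · exact (Measurable.inv (by fun_prop)).aestronglyMeasurable.mul h2.aestronglyMeasurable
  · have hw1 := decayWeight_nonneg p.1
    have hw2 := decayWeight_nonneg p.2
    have hle := decayWeight_le_one p.1
    rw [Real.norm_of_nonneg (by positivity)]
    simp only [Pi.add_apply, ContinuousLinearMap.mul_apply']
    by_cases h : ‖p.1 - p.2‖ < 1
    · rw [Set.indicator_of_mem (Set.mem_Iio.2 h)]
      have : ‖p.1 - p.2‖⁻¹ * (decayWeight p.1 * decayWeight p.2)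
          ≤ ‖p.1 - p.2‖⁻¹ * (1 * decayWeight p.2) := by gcongr
      nlinarith [mul_nonneg hw1 hw2]
    · rw [Set.indicator_of_notMem (by simpa using h)]
      have : ‖p.1 - p.2‖⁻¹ ≤ 1 := inv_le_one_of_one_le₀ (not_lt.1 h)
      nlinarith [mul_nonneg hw1 hw2]

lemma ae_fst_ne_snd (hn : 1 ≤ n) : ∀ᵐ p : Ed n × Ed n, p.1 ≠ p.2 := by
  have : Nontrivial (Ed n) := by
    have : Nonempty (Fin n) := ⟨⟨0, by omega⟩⟩
    infer_instance
  rw [ae_iff, Measure.volume_eq_prod]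
  simp only [ne_eq, not_not]
  rw [Measure.measure_prod_null (measurableSet_eq_fun measurable_fst measurable_snd)]
  refine ae_of_all _ fun x => ?_
  have : Prod.mk x ⁻¹' {p : Ed n × Ed n | p.1 = p.2} = {x} := by
    ext y; simp [eq_comm]
  simp [this]

lemma exists_abs_sum_dx_mul_le (hf : SmoothDecay f) (T : ℝ) :
    ∃ D : ℝ, 0 ≤ D ∧ ∀ t ∈ Set.Icc (-T) T, ∀ x y, |∑ l, dx l f (t, x) * dx l f (t, y)|
      ≤ D * (decayWeight x * decayWeight y) := by
  choose C hC0 hC using fun l => (hf.dx l).exists_le_decayWeight (-T) T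
  refine ⟨∑ l, C l * C l, Finset.sum_nonneg fun l _ => mul_self_nonneg _, fun t ht x y => ?_⟩
  rw [Finset.sum_mul]
  refine (Finset.abs_sum_le_sum_abs _ _).trans (Finset.sum_le_sum fun l _ => ?_)
  rw [abs_mul]
  calc _ ≤ (C l * decayWeight x) * (C l * decayWeight y) :=
        mul_le_mul (hC l t ht x) (hC l t ht y) (abs_nonneg _)
          (mul_nonneg (hC0 l) (decayWeight_nonneg x))
    _ = _ := by ring

lemma morawetzForm_eq {ε : ℝ} (hε : 0 < ε) (hf : SmoothDecay f) (t : ℝ) :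
    morawetzForm ε f t = 1 / 2 * ∫ p : Ed n × Ed n, (∑ k, hessKernel ε k k (p.1 - p.2))
      * ∑ l, dx l f (t, p.1) * dx l f (t, p.2) := by
  have hi := fun k l : Fin n => (bddKernel_hessKernel hε k k).integrable_interaction
    ((hf.dx l).slice_integrable t) ((hf.dx l).slice_integrable t)
  unfold morawetzForm interaction
  rw [← Finset.sum_congr rfl fun k _ => integral_finsetSum Finset.univ fun l _ => hi k l,
    ← integral_finsetSum Finset.univ fun k _ => integrable_finsetSum Finset.univ fun l _ => hi k l]
  congr 2
  funext p
  rw [Finset.sum_mul]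
  refine Finset.sum_congr rfl fun k _ => ?_
  rw [Finset.mul_sum]
  refine Finset.sum_congr rfl fun l _ => ?_
  rw [← neg_sub p.2 p.1, hessKernel_neg]
  ring

/-- The limit of `morawetzForm ε ρ` as `ε → 0`. -/
def limitForm {n : ℕ} (ρ : ℝ × Ed n → ℝ) (t : ℝ) : ℝ :=
  (((n : ℝ) - 1) / 2) * ∫ p : Ed n × Ed n, ‖p.1 - p.2‖⁻¹ *
    ∑ l, dx l ρ (t, p.1) * dx l ρ (t, p.2)

lemma intervalIntegral_limitForm_le (hn : 2 ≤ n) (hf : SmoothDecay f) {c T : ℝ} (hT : 0 ≤ T)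
    (h : ∀ ε > 0, ∫ t in (-T)..T, morawetzForm ε f t ≤ c) :
    ∫ t in (-T)..T, limitForm f t ≤ c := by
  obtain ⟨D, hD0, hD⟩ := exists_abs_sum_dx_mul_le hf T
  have hI : Integrable fun p : Ed n × Ed n =>
      (n * D) * (‖p.1 - p.2‖⁻¹ * (decayWeight p.1 * decayWeight p.2)) :=
    (integrable_inv_norm_mul_decayWeight hn).const_mul _
  have hb : ∀ ε > 0, ∀ t ∈ Set.Icc (-T) T, ∀ᵐ p : Ed n × Ed n,
      ‖(∑ k, hessKernel ε k k (p.1 - p.2)) * ∑ l, dx l f (t, p.1) * dx l f (t, p.2)‖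
        ≤ (n * D) * (‖p.1 - p.2‖⁻¹ * (decayWeight p.1 * decayWeight p.2)) := fun ε hε t ht => by
    filter_upwards [ae_fst_ne_snd (n := n) (by omega)] with p hp
    rw [norm_mul, Real.norm_of_nonneg (trace_hessKernel_nonneg _ hε (by omega))]
    calc _ ≤ (n * ‖p.1 - p.2‖⁻¹) * (D * (decayWeight p.1 * decayWeight p.2)) :=
          mul_le_mul (trace_hessKernel_le _ hε (sub_ne_zero.2 hp)) (hD t ht _ _) (abs_nonneg _)
            (by positivity)
      _ = _ := by ring
  have hlim : ∀ t ∈ Set.Icc (-T) T,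
      Tendsto (fun ε => morawetzForm ε f t) (nhdsWithin 0 (Set.Ioi 0)) (nhds (limitForm f t)) :=
    fun t ht => by
    have hG : Continuous fun p : Ed n × Ed n => ∑ l, dx l f (t, p.1) * dx l f (t, p.2) :=
      continuous_finsetSum _ fun l _ =>
        (((hf.dx l).slice_continuous t).comp continuous_fst).mul
          (((hf.dx l).slice_continuous t).comp continuous_snd)
    have h1 : Tendsto (fun ε => ∫ p : Ed n × Ed n, (∑ k, hessKernel ε k k (p.1 - p.2))
        * ∑ l, dx l f (t, p.1) * dx l f (t, p.2)) (nhdsWithin 0 (Set.Ioi 0))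
        (nhds (∫ p : Ed n × Ed n, (((n : ℝ) - 1) * ‖p.1 - p.2‖⁻¹)
          * ∑ l, dx l f (t, p.1) * dx l f (t, p.2))) := by
      refine tendsto_integral_filter_of_dominated_convergence _ ?_ ?_ hI ?_
      · filter_upwards [self_mem_nhdsWithin] with ε hε
        refine (Continuous.mul (continuous_finsetSum _ fun k _ => ?_) hG).aestronglyMeasurable
        exact (bddKernel_hessKernel hε k k).1.comp (by fun_prop)
      · filter_upwards [self_mem_nhdsWithin] with ε hε using hb ε hε t ht
      · filter_upwards [ae_fst_ne_snd (n := n) (by omega)] with p hp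
        exact (tendsto_trace_hessKernel _ (sub_ne_zero.2 hp)).mul_const _
    have h2 : limitForm f t = 1 / 2 * ∫ p : Ed n × Ed n, (((n : ℝ) - 1) * ‖p.1 - p.2‖⁻¹)
        * ∑ l, dx l f (t, p.1) * dx l f (t, p.2) := by
      simp_rw [limitForm, mul_assoc ((n : ℝ) - 1), integral_const_mul]
      ring
    rw [h2]
    refine (h1.const_mul (1 / 2)).congr' ?_
    filter_upwards [self_mem_nhdsWithin] with ε hε using (morawetzForm_eq hε hf t).symm
  have hsub : ∀ t ∈ Set.uIoc (-T) T, t ∈ Set.Icc (-T) T := fun t ht => by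
    rw [Set.uIoc_of_le (neg_le_self hT)] at ht
    exact Set.Ioc_subset_Icc_self ht
  have hmain := intervalIntegral.tendsto_integral_filter_of_dominated_convergence
    (μ := volume) (a := -T) (b := T) (l := nhdsWithin 0 (Set.Ioi 0))
    (F := fun ε t => morawetzForm ε f t) (f := limitForm f)
    (fun _ => 1 / 2 * ∫ p : Ed n × Ed n,
      (n * D) * (‖p.1 - p.2‖⁻¹ * (decayWeight p.1 * decayWeight p.2)))
    (by filter_upwards [self_mem_nhdsWithin] with ε hε using
          (continuous_morawetzForm hε hf).aestronglyMeasurable)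
    (by
      filter_upwards [self_mem_nhdsWithin] with ε hε
      refine ae_of_all _ fun t ht => ?_
      rw [morawetzForm_eq hε hf, norm_mul, Real.norm_of_nonneg (by norm_num : (0 : ℝ) ≤ 1 / 2)]
      gcongr
      exact norm_integral_le_of_norm_le hI (hb ε hε t (hsub t ht)))
    intervalIntegrable_const (ae_of_all _ fun t ht => hlim t (hsub t ht))
  refine le_of_tendsto hmain ?_
  filter_upwards [self_mem_nhdsWithin] with ε hε using h ε hε

lemma limitForm_eq_iterated (hn : 2 ≤ n) (hf : SmoothDecay f) (t : ℝ) :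
    limitForm f t = (((n : ℝ) - 1) / 2) * ∫ x, ∫ y, ‖x - y‖⁻¹ *
      ∑ l, dx l f (t, x) * dx l f (t, y) := by
  obtain ⟨D, hD0, hD⟩ := exists_abs_sum_dx_mul_le hf |t|
  unfold limitForm
  rw [Measure.volume_eq_prod, integral_prod]
  refine ((integrable_inv_norm_mul_decayWeight hn).const_mul D).mono' ?_
    (ae_of_all _ fun p => ?_)
  · refine (Measurable.inv (by fun_prop)).aestronglyMeasurable.mul
      (Continuous.aestronglyMeasurable ?_)
    exact continuous_finsetSum _ fun l _ =>
        (((hf.dx l).slice_continuous t).comp continuous_fst).mul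
          (((hf.dx l).slice_continuous t).comp continuous_snd)
  · rw [norm_mul, norm_inv, norm_norm]
    calc _ ≤ ‖p.1 - p.2‖⁻¹ * (D * (decayWeight p.1 * decayWeight p.2)) := by
          gcongr
          exact hD t ⟨neg_abs_le t, le_abs_self t⟩ _ _
      _ = _ := by ring

lemma integral_le_of_forall_intervalIntegral_le {F : ℝ → ℝ} {c : ℝ} (hc : 0 ≤ c)
    (h : ∀ T, 0 ≤ T → ∫ t in (-T)..T, F t ≤ c) : ∫ t, F t ≤ c := by
  by_cases hF : Integrable F
  · refine le_of_tendsto (intervalIntegral_tendsto_integral hF tendsto_neg_atTop_atBot tendsto_id)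
      ?_
    filter_upwards [eventually_ge_atTop 0] with T hT using h T hT
  · rwa [integral_undef hF]

end Limit

section Complex

variable {n : ℕ} {U : ℝ × Ed n → ℂ}

lemma SmoothDecay.re (hU : SmoothDecay U) : SmoothDecay fun p => (U p).re :=
  hU.clm_comp reCLM

lemma SmoothDecay.im (hU : SmoothDecay U) : SmoothDecay fun p => (U p).im :=
  hU.clm_comp imCLM

lemma fderiv_re_apply (hU : SmoothDecay U) (p e : ℝ × Ed n) :
    fderiv ℝ (fun p => (U p).re) p e = (fderiv ℝ U p e).re := by
  have h : HasFDerivAt (fun p => (U p).re) _ p :=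
    reCLM.hasFDerivAt.comp p (hU.differentiable p).hasFDerivAt
  rw [h.fderiv]; rfl

lemma fderiv_im_apply (hU : SmoothDecay U) (p e : ℝ × Ed n) :
    fderiv ℝ (fun p => (U p).im) p e = (fderiv ℝ U p e).im := by
  have h : HasFDerivAt (fun p => (U p).im) _ p :=
    imCLM.hasFDerivAt.comp p (hU.differentiable p).hasFDerivAt
  rw [h.fderiv]; rfl

lemma dx_re (hU : SmoothDecay U) (k : Fin n) : dx k (fun p => (U p).re)
    = fun p => (fderiv ℝ U p (0, EuclideanSpace.single k 1)).re :=
  funext fun p => fderiv_re_apply hU p _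

lemma dx_im (hU : SmoothDecay U) (k : Fin n) : dx k (fun p => (U p).im)
    = fun p => (fderiv ℝ U p (0, EuclideanSpace.single k 1)).im :=
  funext fun p => fderiv_im_apply hU p _

variable {u : ℝ → Ed n → ℂ}

lemma pd_slice (hu : SmoothDecay fun p : ℝ × Ed n => u p.1 p.2) (k : Fin n) (t : ℝ) (x : Ed n) :
    pd k (u t) x
    = fderiv ℝ (fun p : ℝ × Ed n => u p.1 p.2) (t, x) (0, EuclideanSpace.single k 1) :=
  fderiv_slice_apply hu.differentiable t x _

lemma lapC_slice (hu : SmoothDecay fun p : ℝ × Ed n => u p.1 p.2) (t : ℝ) (x : Ed n) :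
    lapC (u t) x
    = ((∑ k, dx k (dx k fun p => (u p.1 p.2).re) (t, x) : ℝ) : ℂ)
      + ((∑ k, dx k (dx k fun p => (u p.1 p.2).im) (t, x) : ℝ) : ℂ) * I := by
  have h : ∀ k, pd k (fun y => pd k (u t) y) x
      = (dx k (dx k fun p => (u p.1 p.2).re) (t, x) : ℂ)
        + (dx k (dx k fun p => (u p.1 p.2).im) (t, x) : ℂ) * I := fun k => by
    have h1 := hu.fderiv_apply (0, EuclideanSpace.single k 1)
    simp_rw [pd_slice hu]
    rw [dx_re hu, dx_im hu, dx_re h1, dx_im h1, re_add_im]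
    exact fderiv_slice_apply h1.differentiable t x _
  simp only [lapC, h, Finset.sum_add_distrib, ofReal_sum, Finset.sum_mul]

end Complex

/-- Quadratic Morawetz estimate for the Hartree equation with a smooth
radial nonincreasing potential `V`:
`∫_ℝ ((n-1)/2) ∫∫ ∇ρ(t,x)·∇ρ(t,y)|x-y|⁻¹ dx dy dt ≤ 2 (sup_t ‖u(t)‖₂)³ (sup_t ‖∇u(t)‖₂)`. -/
theorem hartree_quadratic_morawetz_estimate {n : ℕ} (hn : 2 ≤ n)
    (V : Ed n → ℝ) (hVsmooth : ContDiff ℝ (⊤ : ℕ∞) V)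
    (hVbdd : ∀ i : ℕ, ∃ C : ℝ, ∀ x, ‖iteratedFDeriv ℝ i V x‖ ≤ C)
    (v : ℝ → ℝ) (hrad : ∀ x, V x = v ‖x‖)
    (hvdiff : ∀ r : ℝ, 0 < r → DifferentiableAt ℝ v r)
    (hv' : ∀ r : ℝ, 0 < r → deriv v r ≤ 0)
    (u : ℝ → Ed n → ℂ) (hu : IsHartreeSolution V u)
    (hA : BddAbove (Set.range fun t => (∫ x, ‖u t x‖ ^ 2) ^ ((1:ℝ)/2)))
    (hB : BddAbove (Set.range fun t => (∫ x, ∑ k, ‖pd k (u t) x‖ ^ 2) ^ ((1:ℝ)/2))) :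
    (∫ t : ℝ, (((n : ℝ) - 1)/2) * ∫ x, ∫ y, ‖x - y‖⁻¹ *
        ∑ k, pdR k (fun z => dens u t z) x * pdR k (fun z => dens u t z) y)
    ≤ 2 * (⨆ t : ℝ, (∫ x, ‖u t x‖ ^ 2) ^ ((1:ℝ)/2)) ^ 3
        * (⨆ t : ℝ, (∫ x, ∑ k, ‖pd k (u t) x‖ ^ 2) ^ ((1:ℝ)/2)) := by
  have hU : SmoothDecay fun p : ℝ × Ed n => u p.1 p.2 := ⟨hu.1, hu.2.1⟩
  have hre := hU.re
  have him := hU.im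
  set a : ℝ × Ed n → ℝ := fun p => (u p.1 p.2).re with ha
  set b : ℝ × Ed n → ℝ := fun p => (u p.1 p.2).im with hb
  have hρ := hre.massDensity him
  have hnorm : ∀ t x, ‖u t x‖ ^ 2 = massDensity a b (t, x) := fun t x => by
    rw [Complex.sq_norm, normSq_apply]; rfl
  have hgrad : ∀ t x, ∑ k, ‖pd k (u t) x‖ ^ 2 = ∑ k, stress a b k k (t, x) := fun t x =>
    Finset.sum_congr rfl fun k _ => by
      rw [pd_slice hU, Complex.sq_norm, normSq_apply]
      simp only [stress, ha, hb, dx_re hU, dx_im hU, Pi.add_apply, Pi.mul_apply]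
  have heq : ∀ p : ℝ × Ed n, dt a p = -(1 / 2) * ∑ l, dx l (dx l b) p
        + (∫ y, V (p.2 - y) * massDensity a b (p.1, y)) * b p ∧
      dt b p = (1 / 2) * ∑ l, dx l (dx l a) p
        - (∫ y, V (p.2 - y) * massDensity a b (p.1, y)) * a p := by
    rintro ⟨t, x⟩
    have h := hu.2.2 t x
    rw [(hasDerivAt_slice hU.differentiable t x).deriv, lapC_slice hU] at h
    simp_rw [hnorm] at h
    have h1 := congrArg re h
    have h2 := congrArg im h
    have hta : dt a (t, x) = (fderiv ℝ (fun p : ℝ × Ed n => u p.1 p.2) (t, x) (1, 0)).re :=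
      fderiv_re_apply hU _ _
    have htb : dt b (t, x) = (fderiv ℝ (fun p : ℝ × Ed n => u p.1 p.2) (t, x) (1, 0)).im :=
      fderiv_im_apply hU _ _
    rw [hta, htb]
    simp [-ofReal_sum] at h1 h2
    constructor <;> simp only [ha, hb] <;> linarith
  have hV1 : ContDiff ℝ 1 V := hVsmooth.of_le (by exact_mod_cast le_top)
  obtain ⟨C, hC⟩ := hVbdd 0
  obtain ⟨C', hC'⟩ := hVbdd 1
  simp only [norm_iteratedFDeriv_zero, Real.norm_eq_abs] at hC
  simp only [norm_iteratedFDeriv_one] at hC'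
  obtain ⟨c, hc, hceven, hVc⟩ :=
    exists_pdR_radial (hV1.differentiable (by simp)) hrad hvdiff hv'
  simp_rw [hnorm, hgrad] at hA hB ⊢
  set A := ⨆ t : ℝ, (∫ x, massDensity a b (t, x)) ^ ((1 : ℝ) / 2) with hAdef
  set B := ⨆ t : ℝ, (∫ x, ∑ k, stress a b k k (t, x)) ^ ((1 : ℝ) / 2) with hBdef
  have hρ0 : ∀ t, 0 ≤ ∫ x, massDensity a b (t, x) := fun t =>
    integral_nonneg fun x => add_nonneg (mul_self_nonneg _) (mul_self_nonneg _)
  have he0 : ∀ t, 0 ≤ ∫ x, ∑ k, stress a b k k (t, x) := fun t => integral_nonneg fun x =>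
    Finset.sum_nonneg fun k _ => add_nonneg (mul_self_nonneg _) (mul_self_nonneg _)
  have hA0 : 0 ≤ A := (Real.rpow_nonneg (hρ0 0) _).trans (le_ciSup hA 0)
  have hB0 : 0 ≤ B := (Real.rpow_nonneg (he0 0) _).trans (le_ciSup hB 0)
  have hM : ∀ ε > 0, ∀ t, |morawetzAction ε a b t| ≤ A ^ 3 * B := fun ε hε t =>
    (abs_morawetzAction_le hε hre him t).trans <| mul_le_mul
      (pow_le_pow_left₀ (Real.rpow_nonneg (hρ0 t) _) (le_ciSup hA t) 3) (le_ciSup hB t)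
      (Real.rpow_nonneg (he0 t) _) (by positivity)
  have hlim : (fun t : ℝ => (((n : ℝ) - 1) / 2) * ∫ x, ∫ y, ‖x - y‖⁻¹ *
      ∑ k, pdR k (fun z => dens u t z) x * pdR k (fun z => dens u t z) y)
      = limitForm (massDensity a b) := funext fun t => by
    rw [limitForm_eq_iterated hn hρ]
    simp_rw [dens, hnorm, pdR_slice hρ.differentiable]
  rw [hlim, mul_assoc]
  exact integral_le_of_forall_intervalIntegral_le (by positivity) fun T hT =>
    intervalIntegral_limitForm_le hn hρ hT fun ε hε =>
      integral_le_of_le_deriv_of_abs_le (hasDerivAt_morawetzAction hε hre him)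
        (continuous_morawetzForm hε hρ)
        (morawetzForm_le_deriv hε hre him hV1 hC hC' hc hceven hVc (fun p => (heq p).1)
          fun p => (heq p).2) (hM ε hε) hT
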